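/- arXiv:2307.08039 — 3 statements merged into one kernel-verified Lean document; each statement's English description precedes it below -/
import Mathlib

section
/- Every 2-connected k-cactus with n vertices has at most n + k - 1 edges, for every k ≥ 1. Moreover, for every n ≥ k + 2 there exists a 2-connected k-cactus with n vertices and exactly n + k - 1 edges. -/
open SimpleGraph

variable {V : Type}

/-- `C` is a cycle subgraph of `H`. -/
def IsCycleSub (H : SimpleGraph V) (C : H.Subgraph) : Prop :=
  ∃ (v : V) (w : H.Walk v v), w.IsCycle ∧ w.toSubgraph = C

/-- The set of cycle subgraphs of `H` containing the edge `e`. -/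
def CyclesThrough (H : SimpleGraph V) (e : Sym2 V) : Set H.Subgraph :=
  {C | IsCycleSub H C ∧ e ∈ C.edgeSet}

/-- A `k`-cactus: a connected graph in which each edge lies in at most `k` cycles. -/
def IsKCactus (H : SimpleGraph V) (k : ℕ) : Prop :=
  H.Connected ∧ ∀ e ∈ H.edgeSet, (CyclesThrough H e).ncard ≤ k

/-- A graph is 2-connected: at least 3 vertices, connected, and no cut-vertex. -/
def TwoConnected [Fintype V] (H : SimpleGraph V) : Prop :=
  3 ≤ Fintype.card V ∧ H.Connected ∧
    ∀ v : V, ((⊤ : H.Subgraph).deleteVerts {v}).coe.Connected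

/-- A subgraph is 2-connected. -/
def SubTwoConn {H : SimpleGraph V} (B : H.Subgraph) : Prop :=
  3 ≤ B.verts.ncard ∧ B.Connected ∧ ∀ v : V, (B.deleteVerts {v}).coe.Connected

/-- `Q` is an ear of `F` with end-vertices `a` and `b`: a nontrivial path whose
end-vertices lie in `F` but whose internal vertices (and edges) do not. -/
def IsEarWith {H : SimpleGraph V} (F Q : H.Subgraph) (a b : V) : Prop :=
  a ∈ F.verts ∧ b ∈ F.verts ∧
    ∃ p : H.Walk a b, p.IsPath ∧ 1 ≤ p.length ∧ p.toSubgraph = Q ∧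
      (∀ w ∈ p.support, w ≠ a → w ≠ b → w ∉ F.verts) ∧
      ∀ e ∈ p.edges, e ∉ F.edgeSet

/-- `Q` is an ear of `F`. -/
def IsEar {H : SimpleGraph V} (F Q : H.Subgraph) : Prop :=
  ∃ a b, IsEarWith F Q a b

/-- `A` is a `k`-theta subgraph with branch vertices `u` and `v`:
the union of `k` internally disjoint paths from `u` to `v`, at most one of length 1. -/
def IsThetaSubUV {H : SimpleGraph V} (A : H.Subgraph) (k : ℕ) (u v : V) : Prop :=
  u ≠ v ∧ ∃ p : Fin k → H.Walk u v,
    (∀ i, (p i).IsPath) ∧ (∀ i, 1 ≤ (p i).length) ∧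
    (∀ i j, i ≠ j → ∀ w ∈ (p i).support, w ∈ (p j).support → w = u ∨ w = v) ∧
    {i | (p i).length = 1}.Subsingleton ∧
    (⨆ i, (p i).toSubgraph) = A

/-- `A` is a `k`-theta subgraph. -/
def IsThetaSub {H : SimpleGraph V} (A : H.Subgraph) (k : ℕ) : Prop :=
  ∃ u v, IsThetaSubUV A k u v

/-- `G` is (as a whole graph) a `k`-theta graph. -/
def IsThetaGraph (G : SimpleGraph V) (k : ℕ) : Prop :=
  IsThetaSub (⊤ : G.Subgraph) k

/-- `B` is a `θ₃'`-subgraph: a theta graph together with an ear whose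
end-vertices avoid the two branch (degree-3) vertices. -/
def IsThetaPrimeSub {H : SimpleGraph V} (B : H.Subgraph) : Prop :=
  ∃ (A Q : H.Subgraph) (u v a b : V), IsThetaSubUV A 3 u v ∧ IsEarWith A Q a b ∧
    a ≠ u ∧ a ≠ v ∧ b ≠ u ∧ b ≠ v ∧ A ⊔ Q = B

/-- `G` is (as a whole graph) a `θ₃'`-graph. -/
def IsThetaPrimeGraph (G : SimpleGraph V) : Prop :=
  IsThetaPrimeSub (⊤ : G.Subgraph)

/-- The subgraph `B` has no cut-vertex. -/
def NoCutVtx {H : SimpleGraph V} (B : H.Subgraph) : Prop :=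
  ∀ v : V, (B.deleteVerts {v}).coe.Preconnected

/-- `B` is a block of `H`: a maximal connected subgraph without a cut-vertex. -/
def IsBlock (H : SimpleGraph V) (B : H.Subgraph) : Prop :=
  B.Connected ∧ NoCutVtx B ∧
    ∀ C : H.Subgraph, B ≤ C → C.Connected → NoCutVtx C → C = B

/-- `B` is a single-edge subgraph. -/
def IsSingleEdgeSub {H : SimpleGraph V} (B : H.Subgraph) : Prop :=
  ∃ (a b : V) (h : H.Adj a b), B = H.subgraphOfAdj h

/-- The set of cycle subgraphs of `H` lying inside `A` and containing the edge `e`. -/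
def CyclesThroughIn (H : SimpleGraph V) (A : H.Subgraph) (e : Sym2 V) : Set H.Subgraph :=
  {C | IsCycleSub H C ∧ C ≤ A ∧ e ∈ C.edgeSet}

/-- `[Q 0, Q 1, …, Q l]` is an ear decomposition of `H`. -/
def IsEarDecomp (H : SimpleGraph V) (l : ℕ) (Q : Fin (l + 1) → H.Subgraph) : Prop :=
  IsCycleSub H (Q 0) ∧
  (∀ i : Fin (l + 1), 0 < (i : ℕ) →
    IsEar (⨆ j : Fin (l + 1), ⨆ _ : j < i, Q j) (Q i)) ∧
  (∀ i j, i ≠ j → Disjoint (Q i).edgeSet (Q j).edgeSet) ∧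
  (⨆ i, Q i) = ⊤

lemma kc_append_isPath {G : SimpleGraph V} {u v w : V} (p : G.Walk u v) (q : G.Walk v w) :
    (p.append q).IsPath ↔ p.IsPath ∧ q.IsPath ∧ ∀ x ∈ p.support, x ∈ q.support → x = v := by
  induction p with
  | nil => simp
  | cons h p ih =>
    rw [Walk.cons_append, Walk.cons_isPath_iff, ih, Walk.cons_isPath_iff]
    simp only [Walk.mem_support_append_iff, Walk.support_cons, List.mem_cons]
    constructor
    · rintro ⟨⟨h1, h2, h3⟩, h4⟩
      grind
    · rintro ⟨⟨h1, h2⟩, h3, h4⟩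
      refine ⟨⟨h1, h3, fun x hx => h4 x (Or.inr hx)⟩, ?_⟩
      rintro (h5 | h5)
      · exact h2 h5
      · have := h4 _ (Or.inl rfl) h5
        subst this
        exact h2 p.end_mem_support

/-- first hit of a set along a walk -/
lemma kc_first_hit {G : SimpleGraph V} (S : Set V) {w z : V} (p : G.Walk w z) (hz : z ∈ S) :
    ∃ d ∈ S, ∃ q : G.Walk w d, q.IsPath ∧ (∀ x ∈ q.support, x ∈ S → x = d) ∧
      ∀ x ∈ q.support, x ∈ p.support := by
  classical
  suffices h : ∃ d ∈ S, ∃ q : G.Walk w d, (∀ x ∈ q.support, x ∈ S → x = d) ∧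
      ∀ x ∈ q.support, x ∈ p.support by
    obtain ⟨d, hd, q, h1, h2⟩ := h
    exact ⟨d, hd, q.bypass, q.bypass_isPath,
      fun x hx => h1 x (q.support_bypass_subset_support hx), fun x hx => h2 x (q.support_bypass_subset_support hx)⟩
  induction p with
  | nil => exact ⟨_, hz, Walk.nil, by simp, by simp⟩
  | @cons u v w h p ih =>
    by_cases hu : u ∈ S
    · exact ⟨u, hu, Walk.nil, by simp, by simp⟩
    · obtain ⟨d, hd, q, h1, h2⟩ := ih hz
      refine ⟨d, hd, Walk.cons h q, ?_, ?_⟩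
      · intro x hx hxS
        rw [Walk.support_cons, List.mem_cons] at hx
        rcases hx with rfl | hx
        · exact absurd hxS hu
        · exact h1 x hx hxS
      · intro x hx
        rw [Walk.support_cons, List.mem_cons] at hx ⊢
        exact hx.imp id (h2 x)

def KCLinked {G : SimpleGraph V} (B : G.Subgraph) (e : Sym2 V) (a b : V) : Prop :=
  ∃ p : G.Walk a b, p.IsPath ∧ e ∈ p.edges ∧ p.toSubgraph ≤ B

lemma KCLinked.symm {G : SimpleGraph V} {B : G.Subgraph} {e : Sym2 V} {a b : V}
    (h : KCLinked B e a b) : KCLinked B e b a := by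
  obtain ⟨p, h1, h2, h3⟩ := h
  exact ⟨p.reverse, h1.reverse, by simpa using h2, by simpa using h3⟩

lemma kc_supp {G : SimpleGraph V} {B : G.Subgraph} {a b : V} {p : G.Walk a b}
    (h : p.toSubgraph ≤ B) : ∀ x ∈ p.support, x ∈ B.verts :=
  fun _ hx => h.1 (p.mem_verts_toSubgraph.2 hx)

/-- linking a vertex of `B` with an interior vertex of an ear -/
lemma kc_link_one {G : SimpleGraph V} {B : G.Subgraph} {e : Sym2 V}
    (hB : ∀ a ∈ B.verts, ∀ b ∈ B.verts, a ≠ b → KCLinked B e a b)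
    {c d : V} (hc : c ∈ B.verts) (hd : d ∈ B.verts) (hcd : c ≠ d) (q : G.Walk c d)
    (hq : q.IsPath) (hint : ∀ x ∈ q.support, x ∈ B.verts → x = c ∨ x = d)
    {a b : V} (ha : a ∈ B.verts) (hb : b ∈ q.support) (hbB : b ∉ B.verts) :
    KCLinked (B ⊔ q.toSubgraph) e a b := by
  obtain ⟨q1, q2, rfl⟩ := Walk.mem_support_iff_exists_append.1 hb
  rw [kc_append_isPath] at hq
  obtain ⟨h1, h2, h3⟩ := hq
  simp only [Walk.mem_support_append_iff] at hint
  rw [Walk.toSubgraph_append]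
  by_cases hac : a = c
  · subst hac
    obtain ⟨p, p1, p2, p3⟩ := hB a ha d hd hcd
    refine ⟨p.append q2.reverse, ?_, ?_, ?_⟩
    · rw [kc_append_isPath]
      refine ⟨p1, h2.reverse, fun x hx hx2 => ?_⟩
      rw [Walk.support_reverse, List.mem_reverse] at hx2
      rcases hint x (Or.inr hx2) (kc_supp p3 x hx) with rfl | rfl
      · have := h3 _ q1.start_mem_support hx2
        subst this; exact absurd ha hbB
      · rfl
    · simp [p2]
    · rw [Walk.toSubgraph_append, Walk.toSubgraph_reverse]
      exact sup_le (p3.trans le_sup_left) (le_sup_right.trans le_sup_right)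
  · obtain ⟨p, p1, p2, p3⟩ := hB a ha c hc hac
    refine ⟨p.append q1, ?_, ?_, ?_⟩
    · rw [kc_append_isPath]
      refine ⟨p1, h1, fun x hx hx2 => ?_⟩
      rcases hint x (Or.inl hx2) (kc_supp p3 x hx) with rfl | rfl
      · rfl
      · have := h3 _ hx2 q2.end_mem_support
        subst this; exact absurd hd hbB
    · simp [p2]
    · rw [Walk.toSubgraph_append]
      exact sup_le (p3.trans le_sup_left) (le_sup_left.trans le_sup_right)

lemma kc_split {G : SimpleGraph V} {c d a b : V} (q : G.Walk c d) (ha : a ∈ q.support)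
    (hb : b ∈ q.support) :
    (∃ (q1 : G.Walk c a) (q2 : G.Walk a b) (q3 : G.Walk b d), q = q1.append (q2.append q3)) ∨
    (∃ (q1 : G.Walk c b) (q2 : G.Walk b a) (q3 : G.Walk a d), q = q1.append (q2.append q3)) := by
  obtain ⟨r1, r2, rfl⟩ := Walk.mem_support_iff_exists_append.1 ha
  rw [Walk.mem_support_append_iff] at hb
  rcases hb with hb | hb
  · obtain ⟨s1, s2, rfl⟩ := Walk.mem_support_iff_exists_append.1 hb
    exact Or.inr ⟨s1, s2, r2, by rw [Walk.append_assoc]⟩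
  · obtain ⟨s1, s2, rfl⟩ := Walk.mem_support_iff_exists_append.1 hb
    exact Or.inl ⟨r1, s1, s2, rfl⟩

lemma kc_link_two_aux {G : SimpleGraph V} {B : G.Subgraph} {e : Sym2 V}
    {c d : V} (hc : c ∈ B.verts) (hd : d ∈ B.verts) (hB : KCLinked B e c d)
    {a b : V} (q1 : G.Walk c a) (q2 : G.Walk a b) (q3 : G.Walk b d)
    (hq : (q1.append (q2.append q3)).IsPath)
    (hint : ∀ x ∈ (q1.append (q2.append q3)).support, x ∈ B.verts → x = c ∨ x = d)
    (haB : a ∉ B.verts) (hbB : b ∉ B.verts) (hab : a ≠ b) :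
    KCLinked (B ⊔ (q1.append (q2.append q3)).toSubgraph) e a b := by
  obtain ⟨p, p1, p2, p3⟩ := hB
  simp only [kc_append_isPath, Walk.mem_support_append_iff] at hq hint
  obtain ⟨h1, ⟨h2, h3, h4⟩, h5⟩ := hq
  refine ⟨q1.reverse.append (p.append q3.reverse), ?_, ?_, ?_⟩
  · have ea := q2.start_mem_support
    have eb := q2.end_mem_support
    have ec := q1.start_mem_support
    have ed := q3.end_mem_support
    have hs := kc_supp p3
    simp only [kc_append_isPath, Walk.mem_support_append_iff, Walk.support_reverse,
      List.mem_reverse]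
    refine ⟨h1.reverse, ⟨p1, h3.reverse, ?_⟩, ?_⟩
    · intro x hx hx3
      rcases hint x (Or.inr (Or.inr hx3)) (hs x hx) with rfl | rfl
      · have := h5 _ ec (Or.inr hx3)
        subst this; exact absurd hc haB
      · rfl
    · intro x hx hx3
      rcases hx3 with hx3 | hx3
      · rcases hint x (Or.inl hx) (hs x hx3) with rfl | rfl
        · rfl
        · have := h5 _ hx (Or.inr ed)
          subst this; exact absurd hd haB
      · have := h5 _ hx (Or.inr hx3)
        subst this
        exact absurd (h4 _ ea hx3) hab
  · simp [p2]
  · simp only [Walk.toSubgraph_append, Walk.toSubgraph_reverse]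
    refine sup_le (le_sup_left.trans le_sup_right) (sup_le (p3.trans le_sup_left) ?_)
    exact le_sup_right.trans (le_sup_right.trans le_sup_right)

lemma kc_link {G : SimpleGraph V} {B : G.Subgraph} {e : Sym2 V}
    (hB : ∀ a ∈ B.verts, ∀ b ∈ B.verts, a ≠ b → KCLinked B e a b)
    {c d : V} (hc : c ∈ B.verts) (hd : d ∈ B.verts) (hcd : c ≠ d) (q : G.Walk c d)
    (hq : q.IsPath) (hint : ∀ x ∈ q.support, x ∈ B.verts → x = c ∨ x = d) :
    ∀ a ∈ (B ⊔ q.toSubgraph).verts, ∀ b ∈ (B ⊔ q.toSubgraph).verts, a ≠ b →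
      KCLinked (B ⊔ q.toSubgraph) e a b := by
  intro a ha b hb hab
  simp only [Subgraph.verts_sup, Set.mem_union, Walk.mem_verts_toSubgraph] at ha hb
  by_cases haB : a ∈ B.verts
  · by_cases hbB : b ∈ B.verts
    · obtain ⟨p, p1, p2, p3⟩ := hB a haB b hbB hab
      exact ⟨p, p1, p2, p3.trans le_sup_left⟩
    · exact kc_link_one hB hc hd hcd q hq hint haB (hb.resolve_left hbB) hbB
  · by_cases hbB : b ∈ B.verts
    · exact (kc_link_one hB hc hd hcd q hq hint hbB (ha.resolve_left haB) haB).symm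
    · rcases kc_split q (ha.resolve_left haB) (hb.resolve_left hbB) with
        ⟨q1, q2, q3, rfl⟩ | ⟨q1, q2, q3, rfl⟩
      · exact kc_link_two_aux hc hd (hB c hc d hd hcd) q1 q2 q3 hq hint haB hbB hab
      · exact (kc_link_two_aux hc hd (hB c hc d hd hcd) q1 q2 q3 hq hint hbB haB hab.symm).symm

structure KCGood {G : SimpleGraph V} (B : G.Subgraph) (e : Sym2 V) : Prop where
  mem : e ∈ B.edgeSet
  link : ∀ a ∈ B.verts, ∀ b ∈ B.verts, a ≠ b → KCLinked B e a b
  count : B.edgeSet.ncard + 1 ≤ B.verts.ncard + (CyclesThroughIn G B e).ncard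

lemma kc_step [Finite V] {G : SimpleGraph V} {B : G.Subgraph} {e : Sym2 V} (hB : KCGood B e)
    {c w d : V} (hc : c ∈ B.verts) (hd : d ∈ B.verts) (hcd : c ≠ d) (h : G.Adj c w)
    (q : G.Walk w d) (hq : (Walk.cons h q).IsPath)
    (hint : ∀ x ∈ q.support, x ∈ B.verts → x = d)
    (hn : s(c, w) ∉ B.edgeSet) : KCGood (B ⊔ (Walk.cons h q).toSubgraph) e := by
  classical
  have hint' : ∀ x ∈ (Walk.cons h q).support, x ∈ B.verts → x = c ∨ x = d := by
    intro x hx hxB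
    rw [Walk.support_cons, List.mem_cons] at hx
    exact hx.imp id (fun h => hint x h hxB)
  have hq' := (Walk.cons_isPath_iff _ _).1 hq
  refine ⟨?_, kc_link hB.link hc hd hcd _ hq hint', ?_⟩
  · rw [Subgraph.edgeSet_sup]; exact Or.inl hB.mem
  · have hE : (B ⊔ (Walk.cons h q).toSubgraph).edgeSet.ncard ≤ B.edgeSet.ncard + (q.length + 1) := by
      rw [Subgraph.edgeSet_sup]
      refine (Set.ncard_union_le _ _).trans (Nat.add_le_add_left ?_ _)
      have : (Walk.cons h q).toSubgraph.edgeSet = ((Walk.cons h q).edges.toFinset : Set (Sym2 V)) := by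
        ext x; rw [Walk.mem_edges_toSubgraph]; simp
      rw [this, Set.ncard_coe_finset]
      refine (List.toFinset_card_le _).trans ?_
      simp
    have hV : B.verts.ncard + q.length ≤ (B ⊔ (Walk.cons h q).toSubgraph).verts.ncard := by
      have h1 : B.verts ∪ ((q.support.toFinset.erase d : Finset V) : Set V) ⊆
          (B ⊔ (Walk.cons h q).toSubgraph).verts := by
        intro x hx
        rw [Subgraph.verts_sup, Set.mem_union, Walk.mem_verts_toSubgraph]
        rcases hx with hx | hx
        · exact Or.inl hx
        · right
          simp at hx
          simp [hx.1]
      refine le_trans ?_ (Set.ncard_le_ncard h1 (Set.toFinite _))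
      rw [Set.ncard_union_eq ?_ (Set.toFinite _) (Set.toFinite _), Set.ncard_coe_finset,
        Finset.card_erase_of_mem (by simp), List.toFinset_card_of_nodup hq'.1.support_nodup,
        Walk.length_support]
      · simp
      · rw [Set.disjoint_left]
        intro x hx hx2
        simp at hx2
        exact hx2.2 (hint x hx2.1 hx)
    have hC : (CyclesThroughIn G B e).ncard + 1 ≤
        (CyclesThroughIn G (B ⊔ (Walk.cons h q).toSubgraph) e).ncard := by
      obtain ⟨p, p1, p2, p3⟩ := hB.link c hc d hd hcd
      have hcyc : (Walk.cons h (q.append p.reverse)).IsCycle := by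
        rw [Walk.cons_isCycle_iff, kc_append_isPath]
        refine ⟨⟨hq'.1, p1.reverse, ?_⟩, ?_⟩
        · intro x hx hx2
          rw [Walk.support_reverse, List.mem_reverse] at hx2
          exact hint x hx (kc_supp p3 x hx2)
        · rw [Walk.edges_append, List.mem_append, not_or]
          refine ⟨fun hh => hq'.2 (q.fst_mem_support_of_mem_edges hh), fun hh => hn ?_⟩
          rw [Walk.edges_reverse, List.mem_reverse, ← Walk.mem_edges_toSubgraph] at hh
          exact Subgraph.edgeSet_mono p3 hh
      set C := (Walk.cons h (q.append p.reverse)).toSubgraph with hCdef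
      have hCn : C ∉ CyclesThroughIn G B e := by
        rintro ⟨_, h2, _⟩
        apply hn
        apply Subgraph.edgeSet_mono h2
        rw [hCdef, Walk.mem_edges_toSubgraph]; simp
      rw [← Set.ncard_insert_of_notMem hCn (Set.toFinite _)]
      refine Set.ncard_le_ncard ?_ (Set.toFinite _)
      intro D hD
      rcases hD with rfl | ⟨h1, h2, h3⟩
      · refine ⟨⟨_, _, hcyc, rfl⟩, ?_, ?_⟩
        · rw [hCdef]
          simp only [Walk.toSubgraph, Walk.toSubgraph_append, Walk.toSubgraph_reverse]
          refine sup_le (le_sup_left.trans le_sup_right) (sup_le (le_sup_right.trans le_sup_right)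
            (p3.trans le_sup_left))
        · rw [hCdef, Walk.mem_edges_toSubgraph]; simp [p2]
      · exact ⟨h1, h2.trans le_sup_left, h3⟩
    have := hB.count
    omega

lemma kc_base [Finite V] {G : SimpleGraph V} {x y : V} (h : G.Adj x y) :
    KCGood (G.subgraphOfAdj h) s(x, y) := by
  refine ⟨by simp, ?_, ?_⟩
  · have : KCLinked (G.subgraphOfAdj h) s(x, y) x y :=
      ⟨Walk.cons h Walk.nil, by simp [h.ne], by simp, by simp [Walk.toSubgraph]⟩
    intro a ha b hb hab
    simp at ha hb
    rcases ha with rfl | rfl <;> rcases hb with rfl | rfl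
    · exact absurd rfl hab
    · exact this
    · exact this.symm
    · exact absurd rfl hab
  · have : (G.subgraphOfAdj h).verts.ncard = 2 := by
      simp [Set.ncard_pair h.ne]
    rw [this]
    simp

lemma kc_extend [Finite V] {G : SimpleGraph V} {B : G.Subgraph} {e : Sym2 V} (hB : KCGood B e)
    (hconn : G.Connected) (h2 : ∀ v : V, ((⊤ : G.Subgraph).deleteVerts {v}).coe.Connected)
    (hne : B ≠ ⊤) : ∃ B', B < B' ∧ KCGood B' e := by
  suffices h : ∃ c w d, ∃ (h : G.Adj c w) (q : G.Walk w d), c ∈ B.verts ∧ d ∈ B.verts ∧ c ≠ d ∧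
      (Walk.cons h q).IsPath ∧ (∀ x ∈ q.support, x ∈ B.verts → x = d) ∧ s(c, w) ∉ B.edgeSet by
    obtain ⟨c, w, d, h, q, h1, h2, h3, h4, h5, h6⟩ := h
    refine ⟨_, ?_, kc_step hB h1 h2 h3 h q h4 h5 h6⟩
    refine lt_of_le_of_ne le_sup_left ?_
    intro heq
    apply h6
    rw [heq, Subgraph.edgeSet_sup]
    right
    rw [Walk.mem_edges_toSubgraph]; simp
  by_cases hind : ∃ c w, G.Adj c w ∧ c ∈ B.verts ∧ w ∈ B.verts ∧ s(c, w) ∉ B.edgeSet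
  · obtain ⟨c, w, h, h1, h2, h3⟩ := hind
    exact ⟨c, w, w, h, Walk.nil, h1, h2, h.ne, by simp [h.ne], by simp, h3⟩
  · push Not at hind
    have hx : ∃ x y, B.Adj x y := by
      have := hB.mem
      induction e with
      | _ x y => exact ⟨x, y, this⟩
    obtain ⟨x, y, hxy⟩ := hx
    have hz : ∃ z, z ∉ B.verts := by
      by_contra hcon
      push Not at hcon
      apply hne
      ext a b
      · simp [hcon a]
      · exact ⟨fun h => h.adj_sub, fun h => hind a b h (hcon a) (hcon b)⟩
    obtain ⟨z, hz⟩ := hz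
    obtain ⟨p⟩ := hconn x z
    obtain ⟨dt, -, hd1, hd2⟩ := p.exists_boundary_dart B.verts (B.edge_vert hxy) hz
    have hb : ∃ b ∈ B.verts, b ≠ dt.fst := by
      by_cases hxx : x = dt.fst
      · exact ⟨y, B.edge_vert hxy.symm, fun hh => hxy.ne (hxx.trans hh.symm)⟩
      · exact ⟨x, B.edge_vert hxy, hxx⟩
    obtain ⟨b, hbB, hb⟩ := hb
    have hw : dt.snd ∈ ((⊤ : G.Subgraph).deleteVerts {dt.fst}).verts := by
      simpa using dt.adj.ne.symm
    have hb' : b ∈ ((⊤ : G.Subgraph).deleteVerts {dt.fst}).verts := by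
      simpa using hb
    obtain ⟨r⟩ := h2 dt.fst ⟨_, hw⟩ ⟨_, hb'⟩
    obtain ⟨d, hd, q, q1, q2, q3⟩ := kc_first_hit B.verts
      (r.map (Subgraph.hom _) : G.Walk dt.snd b) hbB
    have hav : dt.fst ∉ q.support := by
      intro hh
      have := q3 _ hh
      rw [Walk.support_map, List.mem_map] at this
      obtain ⟨⟨s, hs⟩, -, hs2⟩ := this
      simp at hs hs2
      exact hs hs2
    refine ⟨dt.fst, dt.snd, d, dt.adj, q, hd1, hd, ?_, ?_, q2, ?_⟩
    · rintro rfl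
      exact hav q.end_mem_support
    · exact (Walk.cons_isPath_iff _ _).2 ⟨q1, hav⟩
    · intro hh
      exact hd2 (B.edge_vert (Subgraph.mem_edgeSet.1 hh).symm)

lemma kc_upper [Fintype V] (G : SimpleGraph V) (h : TwoConnected G) (k : ℕ)
    (hk : IsKCactus G k) : G.edgeSet.ncard ≤ Fintype.card V + k - 1 := by
  obtain ⟨h1, h2, h3⟩ := h
  have : Nontrivial V := Fintype.one_lt_card_iff_nontrivial.1 (by omega)
  obtain ⟨x⟩ := h2.nonempty
  obtain ⟨y, hxy⟩ := h2.preconnected.exists_adj_of_nontrivial x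
  have hfin : {B : G.Subgraph | KCGood B s(x, y)}.Finite := Set.toFinite _
  obtain ⟨B, hB⟩ := hfin.exists_maximal ⟨_, kc_base hxy⟩
  have hT : B = ⊤ := by
    by_contra hne
    obtain ⟨B', hlt, hB'⟩ := kc_extend hB.prop h2 h3 hne
    exact absurd hlt (hB.not_gt hB')
  have hc := hB.prop.count
  have hk2 := hk.2 s(x, y) hxy
  subst hT
  have he : CyclesThroughIn G ⊤ s(x, y) = CyclesThrough G s(x, y) := by
    ext C; simp [CyclesThroughIn, CyclesThrough]
  rw [he] at hc
  simp [Set.ncard_univ] at hc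
  omega

def kcRel (n t : ℕ) (a b : Fin n) : Prop :=
  (a.val + 1 = b.val ∧ b.val ≤ t) ∨ (t < b.val ∧ (a.val = 0 ∨ a.val = t))

def kcG (n t : ℕ) : SimpleGraph (Fin n) where
  Adj a b := kcRel n t a b ∨ kcRel n t b a
  symm := ⟨fun _ _ h => h.symm⟩
  loopless := ⟨fun a h => by simp only [kcRel] at h; omega⟩

lemma kcG_adj {n t : ℕ} {a b : Fin n} :
    (kcG n t).Adj a b ↔ kcRel n t a b ∨ kcRel n t b a := Iff.rfl

lemma kc_conn_del {G : SimpleGraph V} (v r : V) (hr : r ≠ v)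
    (h : ∀ a, a ≠ v → Relation.ReflTransGen (fun a b => G.Adj a b ∧ a ≠ v ∧ b ≠ v) a r) :
    ((⊤ : G.Subgraph).deleteVerts {v}).coe.Connected := by
  have hm : ∀ a, a ≠ v → a ∈ ((⊤ : G.Subgraph).deleteVerts {v}).verts := by
    intro a ha; simpa using ha
  have key : ∀ a b, Relation.ReflTransGen (fun a b => G.Adj a b ∧ a ≠ v ∧ b ≠ v) a b →
      ∀ (ha : a ≠ v) (hb : b ≠ v),
      ((⊤ : G.Subgraph).deleteVerts {v}).coe.Reachable ⟨a, hm a ha⟩ ⟨b, hm b hb⟩ := by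
    intro a b hab
    induction hab with
    | refl => intro _ _; exact Reachable.refl _
    | tail h1 h2 ih =>
      intro ha hb
      refine (ih ha h2.2.1).trans (Adj.reachable ?_)
      simp [h2.1, h2.2.1, hb]
  have hroot : ∀ x, ((⊤ : G.Subgraph).deleteVerts {v}).coe.Reachable x ⟨r, hm r hr⟩ := by
    rintro ⟨x, hx⟩
    have hx' : x ≠ v := by simpa using hx
    exact key x r (h x hx') hx' hr
  have : Nonempty ((⊤ : G.Subgraph).deleteVerts {v}).verts := ⟨⟨r, hm r hr⟩⟩
  exact ⟨fun x y => (hroot x).trans (hroot y).symm⟩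

lemma kcG_twoConnected (n t k : ℕ) (hk : 1 ≤ k) (ht : 1 ≤ t) (hn : n = t + k + 1) :
    TwoConnected (kcG n t) := by
  have hdown : ∀ v : Fin n, ∀ i (hi : i < n), i ≤ t → i < v.val → 
      Relation.ReflTransGen (fun a b => (kcG n t).Adj a b ∧ a ≠ v ∧ b ≠ v)
        ⟨i, hi⟩ ⟨0, by omega⟩ := by
    intro v i
    induction i with
    | zero => intro _ _ _; exact .refl
    | succ i ih =>
      intro hi h1 h2
      refine .head ?_ (ih (by omega) (by omega) (by omega))
      simp only [kcG_adj, kcRel, ne_eq, Fin.ext_iff]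
      grind
  have hup : ∀ v : Fin n, ∀ m i (hi : i < n), i + m = t → v.val < i → 
      Relation.ReflTransGen (fun a b => (kcG n t).Adj a b ∧ a ≠ v ∧ b ≠ v)
        ⟨i, hi⟩ ⟨t, by omega⟩ := by
    intro v m
    induction m with
    | zero => intro i _ h _; simp at h; subst h; exact .refl
    | succ m ih =>
      intro i hi h1 h2
      refine .head ?_ (ih (i + 1) (by omega) (by omega) (by omega))
      simp only [kcG_adj, kcRel, ne_eq, Fin.ext_iff]
      grind
  have hdel : ∀ v : Fin n, ((⊤ : (kcG n t).Subgraph).deleteVerts {v}).coe.Connected := by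
    intro v
    by_cases hv : v.val = 0
    · refine kc_conn_del v ⟨t, by omega⟩ (by simp only [Fin.ne_iff_vne]; omega) ?_
      rintro ⟨a, ha⟩ hav
      simp only [Fin.ne_iff_vne] at hav
      by_cases hat : a ≤ t
      · exact hup v (t - a) a ha (by omega) (by omega)
      · refine .single ?_
        simp only [kcG_adj, kcRel, ne_eq, Fin.ext_iff]
        grind
    · refine kc_conn_del v ⟨0, by omega⟩ (by simp only [Fin.ne_iff_vne]; omega) ?_
      rintro ⟨a, ha⟩ hav
      simp only [Fin.ne_iff_vne] at hav
      by_cases hat : a ≤ t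
      · by_cases hlt : a < v.val
        · exact hdown v a ha hat hlt
        · refine (hup v (t - a) a ha (by omega) (by omega)).trans ?_
          refine .head (b := ⟨t + 1, by omega⟩) ?_ (.single ?_) <;>
          · simp only [kcG_adj, kcRel, ne_eq, Fin.ext_iff]
            grind
      · refine .single ?_
        simp only [kcG_adj, kcRel, ne_eq, Fin.ext_iff]
        grind
  refine ⟨by simp; omega, ?_, hdel⟩
  have hroot : ∀ x, (kcG n t).Reachable ⟨0, by omega⟩ x := by
    rintro ⟨a, ha⟩
    by_cases hat : a ≤ t
    · induction a with
      | zero => exact Reachable.refl _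
      | succ a ih =>
        refine (ih (by omega) (by omega)).trans (Adj.reachable ?_)
        simp only [kcG_adj, kcRel]
        grind
    · refine Adj.reachable ?_
      simp only [kcG_adj, kcRel]
      grind
  have : Nonempty (Fin n) := ⟨⟨0, by omega⟩⟩
  exact ⟨fun x y => (hroot x).symm.trans (hroot y)⟩

lemma kc_cyc_two {G : SimpleGraph V} {C : G.Subgraph} (hC : IsCycleSub G C) {v a : V}
    (h : C.Adj v a) : (C.neighborSet v).ncard = 2 := by
  obtain ⟨u, w, hw, rfl⟩ := hC
  exact hw.ncard_neighborSet_toSubgraph_eq_two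
    (w.mem_verts_toSubgraph.1 (w.toSubgraph.edge_vert h))

lemma kc_cyc_verts {G : SimpleGraph V} {C : G.Subgraph} (hC : IsCycleSub G C) {v : V} :
    v ∈ C.verts ↔ ∃ a, C.Adj v a := by
  refine ⟨fun h => ?_, fun ⟨a, ha⟩ => C.edge_vert ha⟩
  obtain ⟨u, w, hw, rfl⟩ := hC
  have := hw.ncard_neighborSet_toSubgraph_eq_two (w.mem_verts_toSubgraph.1 h)
  exact Set.nonempty_of_ncard_ne_zero (s := w.toSubgraph.neighborSet v) (by omega)

lemma kc_cyc_forced {G : SimpleGraph V} {C : G.Subgraph} (hC : IsCycleSub G C) {v a b : V}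
    (hv : ∀ x, G.Adj v x → x = a ∨ x = b) (h : C.Adj v a) : C.Adj v b := by
  by_contra hb
  have h2 := kc_cyc_two hC h
  have hsub : C.neighborSet v ⊆ {a} := by
    intro x hx
    rcases hv x hx.adj_sub with rfl | rfl
    · rfl
    · exact absurd hx hb
  have := Set.ncard_le_ncard hsub
  simp at this
  omega

lemma kcG_char (n t k : ℕ) (hk : 1 ≤ k) (ht : 1 ≤ t) (hn : n = t + k + 1)
    {C : (kcG n t).Subgraph} (hC : IsCycleSub _ C) (a b : Fin n) (hab : kcRel n t a b) :
    C.Adj a b ↔ C.Adj ⟨0, by omega⟩ (if b.val ≤ t then ⟨1, by omega⟩ else b) := by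
  have hpath : ∀ i (hi : i + 1 ≤ t), C.Adj ⟨i, by omega⟩ ⟨i + 1, by omega⟩ ↔
      C.Adj ⟨0, by omega⟩ ⟨1, by omega⟩ := by
    intro i
    induction i with
    | zero => intro hi; rfl
    | succ i ih =>
      intro hi
      rw [← ih (by omega), C.adj_comm ⟨i, _⟩]
      constructor
      · apply kc_cyc_forced hC
        intro x hx
        simp only [kcG_adj, kcRel, Fin.ext_iff] at hx ⊢
        omega
      · apply kc_cyc_forced hC
        intro x hx
        simp only [kcG_adj, kcRel, Fin.ext_iff] at hx ⊢
        omega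
  obtain ⟨a, ha⟩ := a
  obtain ⟨b, hb⟩ := b
  simp only [kcRel] at hab
  by_cases hbt : b ≤ t
  · have : b = a + 1 := by omega
    subst this
    simp only [hbt, if_true]
    exact hpath a hbt
  · simp only [hbt, if_false]
    have h0 : a = 0 ∨ a = t := by omega
    rcases h0 with rfl | rfl
    · rfl
    · rw [C.adj_comm, C.adj_comm ⟨0, _⟩]
      constructor
      · apply kc_cyc_forced hC
        intro x hx
        simp only [kcG_adj, kcRel, Fin.ext_iff] at hx ⊢
        omega
      · apply kc_cyc_forced hC
        intro x hx
        simp only [kcG_adj, kcRel, Fin.ext_iff] at hx ⊢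
        omega

lemma kcG_cycles (n t k : ℕ) (hk : 1 ≤ k) (ht : 1 ≤ t) (hn : n = t + k + 1) (a b : Fin n)
    (hab : kcRel n t a b) : (CyclesThrough (kcG n t) s(a, b)).ncard ≤ k := by
  set z : Fin n := ⟨0, by omega⟩ with hz
  set s : Fin n := if b.val ≤ t then ⟨1, by omega⟩ else b with hs
  let g : Fin (k + 1) → Fin n := fun i =>
    if i.val = 0 then ⟨1, by omega⟩ else ⟨t + i.val, by omega⟩
  have hg : ∀ x, (kcG n t).Adj z x → x ∈ Set.range g := by
    intro x hx
    simp only [kcG_adj, kcRel, hz] at hx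
    by_cases hx1 : x.val = 1
    · exact ⟨⟨0, by omega⟩, Fin.ext hx1.symm⟩
    · refine ⟨⟨x.val - t, by omega⟩, ?_⟩
      have : x.val - t ≠ 0 := by omega
      simp only [g, this, if_false, Fin.ext_iff]
      omega
  have hsg : s ∈ Set.range g := by
    apply hg
    simp only [kcG_adj, kcRel, hz, hs]
    split_ifs
    · simp; omega
    · left; right; constructor
      · omega
      · simp
  have hT : (Set.range g \ {s}).ncard ≤ k := by
    have h1 := Set.ncard_sdiff_singleton_add_one hsg (Set.toFinite _)
    have h2 : (Set.range g).ncard ≤ k + 1 := by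
      rw [← Set.image_univ]
      refine (Set.ncard_image_le (Set.toFinite _)).trans ?_
      simp [Set.ncard_univ]
    omega
  refine le_trans ?_ hT
  refine le_trans ?_ (Set.ncard_image_le (f := fun j => ({s, j} : Set (Fin n))) (Set.toFinite _))
  refine Set.ncard_le_ncard_of_injOn (fun C => C.neighborSet z) ?_ ?_ (Set.toFinite _)
  · rintro C ⟨hC, he⟩
    have hsC : C.Adj z s := (kcG_char n t k hk ht hn hC a b hab).1 he
    have h2 := kc_cyc_two hC hsC
    rw [Set.ncard_eq_two] at h2
    obtain ⟨x, y, hxy, hxyC⟩ := h2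
    have hsm : s ∈ C.neighborSet z := hsC
    have hx : x ∈ C.neighborSet z := by rw [hxyC]; simp
    have hy : y ∈ C.neighborSet z := by rw [hxyC]; simp
    rw [hxyC] at hsm
    rcases hsm with h | h
    · exact ⟨y, ⟨hg y hy.adj_sub, fun hh => hxy (h.symm.trans hh.symm)⟩, by simp [hxyC, h]⟩
    · have h : s = y := h
      exact ⟨x, ⟨hg x hx.adj_sub, fun hh => hxy (Eq.trans hh h)⟩, by simp [hxyC, h, Set.pair_comm]⟩
  · rintro C ⟨hC, -⟩ D ⟨hD, -⟩ hCD
    have hCD' : ∀ x, C.Adj z x ↔ D.Adj z x := fun x => Set.ext_iff.1 hCD x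
    have hrel : ∀ x y, kcRel n t x y → (C.Adj x y ↔ D.Adj x y) := by
      intro x y hxy
      rw [kcG_char n t k hk ht hn hC x y hxy, kcG_char n t k hk ht hn hD x y hxy]
      exact hCD' _
    have hadj : ∀ x y, C.Adj x y ↔ D.Adj x y := by
      intro x y
      by_cases hxy : (kcG n t).Adj x y
      · rcases hxy with h | h
        · exact hrel x y h
        · rw [C.adj_comm, D.adj_comm]; exact hrel y x h
      · exact ⟨fun h => absurd h.adj_sub hxy, fun h => absurd h.adj_sub hxy⟩
    ext x y
    · rw [kc_cyc_verts hC, kc_cyc_verts hD]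
      simp only [hadj]
    · exact hadj x y

lemma kcG_edges (n t k : ℕ) (ht : 1 ≤ t) (hn : n = t + k + 1) :
    (kcG n t).edgeSet.ncard = n + k - 1 := by
  let f : Fin t ⊕ (Fin k × Bool) → Fin n × Fin n := Sum.elim
    (fun i => (⟨i.val, by omega⟩, ⟨i.val + 1, by omega⟩))
    (fun x => (⟨if x.2 then 0 else t, by split_ifs <;> omega⟩, ⟨t + 1 + x.1.val, by omega⟩))
  have hfr : ∀ p, (f p).1.val < (f p).2.val := by
    rintro (i | ⟨i, b⟩)
    · simp [f]
    · cases b <;> simp [f] <;> omega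
  have hf : Function.Injective f := by
    rintro (i | ⟨i, b⟩) (j | ⟨j, c⟩) h
    · simp [f, Fin.ext_iff] at h
      simp [Fin.ext_iff, h]
    · simp [f] at h
      omega
    · simp [f] at h
      omega
    · cases b <;> cases c <;> simp [f, Fin.ext_iff] at h ⊢ <;> grind
  have hf2 : Function.Injective (fun p => s((f p).1, (f p).2)) := by
    intro p q h
    apply hf
    have hp := hfr p
    have hq := hfr q
    simp only [Sym2.eq_iff] at h
    rcases h with h | h
    · exact Prod.ext h.1 h.2
    · rw [h.1, h.2] at hp
      omega
  have hE : (kcG n t).edgeSet = Set.range (fun p => s((f p).1, (f p).2)) := by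
    have hrel : ∀ a b, kcRel n t a b → ∃ p, f p = (a, b) := by
      rintro ⟨a, ha⟩ ⟨b, hb⟩ h
      simp only [kcRel] at h
      by_cases hbt : b ≤ t
      · refine ⟨Sum.inl ⟨a, by omega⟩, ?_⟩
        simp [f]; omega
      · by_cases ha0 : a = 0
        · refine ⟨Sum.inr (⟨b - t - 1, by omega⟩, true), ?_⟩
          simp [f]; omega
        · refine ⟨Sum.inr (⟨b - t - 1, by omega⟩, false), ?_⟩
          simp [f]; omega
    ext e
    induction e with
    | _ a b =>
      constructor
      · rintro (h | h)
        · obtain ⟨p, hp⟩ := hrel a b h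
          exact ⟨p, by simp [hp]⟩
        · obtain ⟨p, hp⟩ := hrel b a h
          exact ⟨p, by simp [hp, Sym2.eq_swap]⟩
      · rintro ⟨p, hp⟩
        rw [← hp]
        refine Or.inl ?_
        rcases p with i | ⟨i, b⟩
        · simp only [f, kcRel, Sum.elim_inl]; grind
        · cases b <;> simp only [f, kcRel, Sum.elim_inr] <;> grind
  rw [hE, ← Set.image_univ, Set.ncard_image_of_injective _ hf2, Set.ncard_univ]
  simp
  omega

/-- Every 2-connected `k`-cactus with `n` vertices has at most `n + k - 1` edges,
and for every `n ≥ k + 2` the bound is attained. -/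
theorem twoConnected_kCactus_size (k : ℕ) (hk : 1 ≤ k) :
    (∀ (V : Type) [Fintype V] (G : SimpleGraph V), TwoConnected G → IsKCactus G k →
      G.edgeSet.ncard ≤ Fintype.card V + k - 1) ∧
    (∀ n : ℕ, k + 2 ≤ n → ∃ G : SimpleGraph (Fin n), TwoConnected G ∧ IsKCactus G k ∧
      G.edgeSet.ncard = n + k - 1) := by
  refine ⟨fun V _ G h1 h2 => kc_upper G h1 k h2, fun n hn => ?_⟩
  have ht : 1 ≤ n - k - 1 := by omega
  have hn' : n = (n - k - 1) + k + 1 := by omega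
  have h2 := kcG_twoConnected n (n - k - 1) k hk ht hn'
  refine ⟨kcG n (n - k - 1), h2, ⟨h2.2.1, ?_⟩, kcG_edges n (n - k - 1) k ht hn'⟩
  intro e
  induction e with
  | _ a b =>
    rintro (h | h)
    · exact kcG_cycles n _ k hk ht hn' a b h
    · rw [Sym2.eq_swap]
      exact kcG_cycles n _ k hk ht hn' b a h
end

section
/- Every 2-cactus graph with n vertices has at most ⌊5(n-1)/3⌋ edges, and every 3-cactus graph with n vertices has at most ⌊7(n-1)/4⌋ edges; both bounds are attained for every n. -/
open SimpleGraph

variable {V : Type}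

/-! ### Abstract cycle systems -/

section Abstract

variable {E : Type} [DecidableEq E]

/-- The combinatorial data of a spanning tree with its fundamental cycles. -/
structure CycSys (T Q : Finset E) (k : ℕ) where
  Cyc : Finset E → Prop
  Ev : Finset E → Prop
  C : E → Finset E
  disj : ∀ a ∈ Q, a ∉ T
  ev_symm : ∀ S S', Ev S → Ev S' → Ev (symmDiff S S')
  uniq : ∀ S S', Ev S → Ev S' → (∀ x, x ∉ T → (x ∈ S ↔ x ∈ S')) → S = S'
  cyc_ev : ∀ S, Cyc S → Ev S
  cyc_card : ∀ S, Cyc S → 3 ≤ S.card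
  ev_cyc : ∀ S a, Ev S → a ∈ S → ∃ D, D ⊆ S ∧ a ∈ D ∧ Cyc D
  bound : ∀ (a : E) (F : Finset (Finset E)), (∀ D ∈ F, Cyc D ∧ a ∈ D) → F.card ≤ k
  C_cyc : ∀ a ∈ Q, Cyc (C a)
  C_mem : ∀ a ∈ Q, a ∈ C a
  C_sub : ∀ a ∈ Q, ∀ x ∈ C a, x ∈ T ∨ x = a

namespace CycSys

variable {T Q : Finset E} {k : ℕ} (s : CycSys T Q k)

lemma C_ev {a : E} (ha : a ∈ Q) : s.Ev (s.C a) := s.cyc_ev _ (s.C_cyc a ha)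

lemma mem_iff {a x : E} (ha : a ∈ Q) (hx : x ∉ T) : x ∈ s.C a ↔ x = a := by
  constructor
  · intro h
    rcases s.C_sub a ha x h with h | h
    · exact absurd h hx
    · exact h
  · rintro rfl
    exact s.C_mem _ ha

lemma cyc2 {a b x : E} (ha : a ∈ Q) (hb : b ∈ Q) (hab : a ≠ b) (hxa : x ∈ s.C a)
    (hxb : x ∈ s.C b) : s.Cyc (symmDiff (s.C a) (s.C b)) := by
  have hev := s.ev_symm _ _ (s.C_ev ha) (s.C_ev hb)
  have haS : a ∈ symmDiff (s.C a) (s.C b) := by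
    rw [Finset.mem_symmDiff]
    left
    exact ⟨s.C_mem a ha, by rw [s.mem_iff hb (s.disj a ha)]; exact hab⟩
  obtain ⟨D, hDS, haD, hD⟩ := s.ev_cyc _ a hev haS
  by_cases hbD : b ∈ D
  · have : D = symmDiff (s.C a) (s.C b) := by
      apply s.uniq _ _ (s.cyc_ev _ hD) hev
      intro y hy
      refine ⟨fun h => hDS h, fun h => ?_⟩
      rw [Finset.mem_symmDiff, s.mem_iff ha hy, s.mem_iff hb hy] at h
      grind
    rwa [← this]
  · exfalso
    have : D = s.C a := by
      apply s.uniq _ _ (s.cyc_ev _ hD) (s.C_ev ha)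
      intro y hy
      rw [s.mem_iff ha hy]
      constructor
      · intro h
        have h' := hDS h
        rw [Finset.mem_symmDiff, s.mem_iff ha hy, s.mem_iff hb hy] at h'
        grind
      · rintro rfl
        exact haD
    have h1 := hDS (this ▸ hxa)
    rw [Finset.mem_symmDiff] at h1
    grind

lemma cyc3 {a b c : E} (ha : a ∈ Q) (hb : b ∈ Q) (hc : c ∈ Q) (hab : a ≠ b) (hac : a ≠ c)
    (hbc : b ≠ c)
    (h1 : ∃ x ∈ s.C a, ¬ (x ∈ s.C b ↔ x ∈ s.C c))
    (h2 : ∃ x ∈ s.C c, ¬ (x ∈ s.C a ↔ x ∈ s.C b))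
    (h3 : ∃ x ∈ s.C b, ¬ (x ∈ s.C a ↔ x ∈ s.C c)) :
    s.Cyc (symmDiff (symmDiff (s.C a) (s.C b)) (s.C c)) := by
  have hev2 := s.ev_symm _ _ (s.C_ev ha) (s.C_ev hb)
  have hev2' := s.ev_symm _ _ (s.C_ev ha) (s.C_ev hc)
  have hev := s.ev_symm _ _ hev2 (s.C_ev hc)
  have haS : a ∈ symmDiff (symmDiff (s.C a) (s.C b)) (s.C c) := by
    rw [Finset.mem_symmDiff, Finset.mem_symmDiff, s.mem_iff ha (s.disj a ha),
      s.mem_iff hb (s.disj a ha), s.mem_iff hc (s.disj a ha)]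
    grind
  obtain ⟨D, hDS, haD, hD⟩ := s.ev_cyc _ a hev haS
  have key : ∀ y ∉ T, y ∈ D → y = a ∨ y = b ∨ y = c := by
    intro y hy h
    have h' := hDS h
    rw [Finset.mem_symmDiff, Finset.mem_symmDiff, s.mem_iff ha hy, s.mem_iff hb hy,
      s.mem_iff hc hy] at h'
    tauto
  by_cases hbD : b ∈ D <;> by_cases hcD : c ∈ D
  · have : D = symmDiff (symmDiff (s.C a) (s.C b)) (s.C c) := by
      apply s.uniq _ _ (s.cyc_ev _ hD) hev
      intro y hy
      refine ⟨fun h => hDS h, fun h => ?_⟩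
      rw [Finset.mem_symmDiff, Finset.mem_symmDiff, s.mem_iff ha hy, s.mem_iff hb hy,
        s.mem_iff hc hy] at h
      grind
    rwa [← this]
  · exfalso
    have : D = symmDiff (s.C a) (s.C b) := by
      apply s.uniq _ _ (s.cyc_ev _ hD) hev2
      intro y hy
      rw [Finset.mem_symmDiff, s.mem_iff ha hy, s.mem_iff hb hy]
      have := key y hy
      grind
    obtain ⟨x, hx, hx'⟩ := h2
    have h4 : x ∈ D := by
      rw [this, Finset.mem_symmDiff]
      tauto
    have h5 := hDS h4
    rw [Finset.mem_symmDiff, Finset.mem_symmDiff] at h5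
    tauto
  · exfalso
    have : D = symmDiff (s.C a) (s.C c) := by
      apply s.uniq _ _ (s.cyc_ev _ hD) hev2'
      intro y hy
      rw [Finset.mem_symmDiff, s.mem_iff ha hy, s.mem_iff hc hy]
      have := key y hy
      grind
    obtain ⟨x, hx, hx'⟩ := h3
    have h4 : x ∈ D := by
      rw [this, Finset.mem_symmDiff]
      tauto
    have h5 := hDS h4
    rw [Finset.mem_symmDiff, Finset.mem_symmDiff] at h5
    tauto
  · exfalso
    have : D = s.C a := by
      apply s.uniq _ _ (s.cyc_ev _ hD) (s.C_ev ha)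
      intro y hy
      rw [s.mem_iff ha hy]
      have := key y hy
      grind
    obtain ⟨x, hx, hx'⟩ := h1
    have h5 := hDS (this ▸ hx)
    rw [Finset.mem_symmDiff, Finset.mem_symmDiff] at h5
    tauto

/-- If `a`, `b`, `c` are such that `C a` meets `C b`, `C c` and the triple sum is a cycle,
there are four cycles through `a`. -/
lemma four_le {a b c x y : E} (ha : a ∈ Q) (hb : b ∈ Q) (hc : c ∈ Q) (hab : a ≠ b) (hac : a ≠ c)
    (hbc : b ≠ c) (hx : x ∈ s.C a) (hx' : x ∈ s.C b) (hy : y ∈ s.C a) (hy' : y ∈ s.C c)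
    (h1 : ∃ x ∈ s.C a, ¬ (x ∈ s.C b ↔ x ∈ s.C c))
    (h2 : ∃ x ∈ s.C c, ¬ (x ∈ s.C a ↔ x ∈ s.C b))
    (h3 : ∃ x ∈ s.C b, ¬ (x ∈ s.C a ↔ x ∈ s.C c)) : 4 ≤ k := by
  have c3 := s.cyc3 ha hb hc hab hac hbc h1 h2 h3
  have c2 := s.cyc2 ha hb hab hx hx'
  have c2' := s.cyc2 ha hc hac hy hy'
  have c1 := s.C_cyc a ha
  have taa := s.mem_iff ha (s.disj a ha)
  have tab := s.mem_iff ha (s.disj b hb)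
  have tac := s.mem_iff ha (s.disj c hc)
  have tba := s.mem_iff hb (s.disj a ha)
  have tbb := s.mem_iff hb (s.disj b hb)
  have tbc := s.mem_iff hb (s.disj c hc)
  have tca := s.mem_iff hc (s.disj a ha)
  have tcb := s.mem_iff hc (s.disj b hb)
  have tcc := s.mem_iff hc (s.disj c hc)
  have m2 : a ∈ symmDiff (s.C a) (s.C b) := by grind [Finset.mem_symmDiff]
  have m2' : a ∈ symmDiff (s.C a) (s.C c) := by grind [Finset.mem_symmDiff]
  have m3 : a ∈ symmDiff (symmDiff (s.C a) (s.C b)) (s.C c) := by grind [Finset.mem_symmDiff]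
  have b2 : b ∈ symmDiff (s.C a) (s.C b) := by grind [Finset.mem_symmDiff]
  have b2' : b ∉ symmDiff (s.C a) (s.C c) := by grind [Finset.mem_symmDiff]
  have b3 : b ∈ symmDiff (symmDiff (s.C a) (s.C b)) (s.C c) := by grind [Finset.mem_symmDiff]
  have d2 : c ∉ symmDiff (s.C a) (s.C b) := by grind [Finset.mem_symmDiff]
  have d2' : c ∈ symmDiff (s.C a) (s.C c) := by grind [Finset.mem_symmDiff]
  have d3 : c ∈ symmDiff (symmDiff (s.C a) (s.C b)) (s.C c) := by grind [Finset.mem_symmDiff]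
  have hb1 : b ∉ s.C a := by grind
  have hc1 : c ∉ s.C a := by grind
  have := s.bound a {s.C a, symmDiff (s.C a) (s.C b), symmDiff (s.C a) (s.C c),
    symmDiff (symmDiff (s.C a) (s.C b)) (s.C c)} (by
      intro D hD
      simp only [Finset.mem_insert, Finset.mem_singleton] at hD
      rcases hD with rfl | rfl | rfl | rfl
      · exact ⟨c1, s.C_mem a ha⟩
      · exact ⟨c2, m2⟩
      · exact ⟨c2', m2'⟩
      · exact ⟨c3, m3⟩)
  rw [Finset.card_insert_of_notMem, Finset.card_insert_of_notMem, Finset.card_insert_of_notMem,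
    Finset.card_singleton] at this
  · exact this
  · simp only [Finset.mem_singleton]
    intro h; rw [h] at b2'; exact b2' b3
  · simp only [Finset.mem_insert, Finset.mem_singleton]
    rintro (h | h)
    · rw [h] at b2; exact b2' b2
    · rw [h] at d2; exact d2 d3
  · simp only [Finset.mem_insert, Finset.mem_singleton]
    rintro (h | h | h)
    · rw [h] at hb1; exact hb1 b2
    · rw [h] at hc1; exact hc1 d2'
    · rw [h] at hc1; exact hc1 d3

/-- Two fundamental cycles conflict if they share an edge. -/
def Conf (a b : E) : Prop := ∃ x, x ∈ s.C a ∧ x ∈ s.C b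

lemma conf_refl {a : E} (ha : a ∈ Q) : s.Conf a a := ⟨a, s.C_mem a ha, s.C_mem a ha⟩

lemma conf_symm {a b : E} (h : s.Conf a b) : s.Conf b a := by
  obtain ⟨x, h1, h2⟩ := h
  exact ⟨x, h2, h1⟩

lemma conf_trans (hk : k ≤ 3) {a b c : E} (ha : a ∈ Q) (hb : b ∈ Q) (hc : c ∈ Q)
    (hab : s.Conf a b) (hbc : s.Conf b c) : s.Conf a c := by
  by_contra hac
  have n1 : b ≠ a := by rintro rfl; exact hac hbc
  have n2 : b ≠ c := by rintro rfl; exact hac hab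
  have n3 : a ≠ c := by rintro rfl; exact hac (s.conf_refl ha)
  obtain ⟨x, hxa, hxb⟩ := hab
  obtain ⟨y, hyb, hyc⟩ := hbc
  have hxc : x ∉ s.C c := fun h => hac ⟨x, hxa, h⟩
  have hya : y ∉ s.C a := fun h => hac ⟨y, h, hyc⟩
  have := s.four_le hb ha hc n1 n2 n3 hxb hxa hyb hyc ⟨x, hxb, by tauto⟩ ⟨y, hyc, by tauto⟩
    ⟨x, hxa, by tauto⟩
  omega

open Classical in
/-- The conflict class of a chord. -/
noncomputable def cl (a : E) : Finset E := Q.filter (fun b => s.Conf a b)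

lemma mem_cl {a b : E} : b ∈ s.cl a ↔ b ∈ Q ∧ s.Conf a b := by simp [cl]

lemma cl_card_le {a : E} (ha : a ∈ Q) : (s.cl a).card ≤ k := by
  classical
  have hinj : Set.InjOn (fun b => if b = a then s.C a else symmDiff (s.C a) (s.C b)) (s.cl a) := by
    intro b hb c hc h
    have hb := (s.mem_cl.1 hb).1
    have hc := (s.mem_cl.1 hc).1
    have tab := s.mem_iff ha (s.disj b hb)
    have tac := s.mem_iff ha (s.disj c hc)
    have tbb := s.mem_iff hb (s.disj b hb)
    have tbc := s.mem_iff hb (s.disj c hc)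
    have tcb := s.mem_iff hc (s.disj b hb)
    have tcc := s.mem_iff hc (s.disj c hc)
    by_contra hne
    have e1 := Finset.ext_iff.1 h b
    have e2 := Finset.ext_iff.1 h c
    dsimp only at e1 e2
    split_ifs at e1 e2 <;> simp only [Finset.mem_symmDiff] at e1 e2 <;> grind
  rw [← Finset.card_image_of_injOn hinj]
  apply s.bound a
  intro D hD
  obtain ⟨b, hb, rfl⟩ := Finset.mem_image.1 hD
  obtain ⟨hb, x, hxa, hxb⟩ := s.mem_cl.1 hb
  split_ifs with h
  · exact ⟨s.C_cyc a ha, s.C_mem a ha⟩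
  · refine ⟨s.cyc2 ha hb (Ne.symm h) hxa hxb, ?_⟩
    rw [Finset.mem_symmDiff, s.mem_iff ha (s.disj a ha), s.mem_iff hb (s.disj a ha)]
    grind

/-- Tree part of a fundamental cycle. -/
def tp (a : E) : Finset E := s.C a ∩ T

lemma tp_card {a : E} (ha : a ∈ Q) : 2 ≤ (s.tp a).card := by
  have h3 := s.cyc_card _ (s.C_cyc a ha)
  have : s.C a ⊆ insert a (s.tp a) := by
    intro x hx
    rcases s.C_sub a ha x hx with h | h
    · simp [tp, hx, h]
    · simp [h]
  have h1 := Finset.card_le_card this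
  have h2 := Finset.card_insert_le a (s.tp a)
  omega

lemma tp_ne {a b : E} (ha : a ∈ Q) (hb : b ∈ Q) (hab : a ≠ b) : s.tp a ≠ s.tp b := by
  intro h
  have hev := s.ev_symm _ _ (s.C_ev ha) (s.C_ev hb)
  have haS : a ∈ symmDiff (s.C a) (s.C b) := by
    rw [Finset.mem_symmDiff]
    left
    exact ⟨s.C_mem a ha, by rw [s.mem_iff hb (s.disj a ha)]; exact hab⟩
  obtain ⟨D, hDS, haD, hD⟩ := s.ev_cyc _ a hev haS
  have hsub : D ⊆ {a, b} := by
    intro x hx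
    have h1 := hDS hx
    rw [Finset.mem_symmDiff] at h1
    have h2 := Finset.ext_iff.1 h x
    simp only [tp, Finset.mem_inter] at h2
    have h3 := s.C_sub a ha x
    have h4 := s.C_sub b hb x
    simp only [Finset.mem_insert, Finset.mem_singleton]
    tauto
  have h1 := Finset.card_le_card hsub
  have h2 := Finset.card_le_two (a := a) (b := b)
  have h3 := s.cyc_card _ hD
  omega

lemma three_sets {X Y Z U : Finset E} (hX : X ⊆ U) (hY : Y ⊆ U) (hZ : Z ⊆ U) (hU : U.card ≤ 3)
    (cX : 2 ≤ X.card) (cY : 2 ≤ Y.card) (cZ : 2 ≤ Z.card) (hXY : X ≠ Y) (hXZ : X ≠ Z)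
    (hYZ : Y ≠ Z) : ∃ x ∈ X, ¬ (x ∈ Y ↔ x ∈ Z) := by
  by_contra hcon
  push Not at hcon
  have : ∃ z, ¬ (z ∈ Y ↔ z ∈ Z) := by
    by_contra h
    push Not at h
    exact hYZ (Finset.ext h)
  obtain ⟨z, hz⟩ := this
  have hzU : z ∈ U := by
    by_contra h
    exact hz ⟨fun h' => absurd (hY h') h, fun h' => absurd (hZ h') h⟩
  have hc : (U.erase z).card ≤ 2 := by
    rw [Finset.card_erase_of_mem hzU]; omega
  have key : ∀ W ⊆ U, 2 ≤ W.card → z ∉ W → W = U.erase z := by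
    intro W hW cW hzW
    apply Finset.eq_of_subset_of_card_le
    · intro w hw
      rw [Finset.mem_erase]
      exact ⟨by rintro rfl; exact hzW hw, hW hw⟩
    · omega
  have hzX : z ∉ X := fun h => hz (hcon z h)
  have eX := key X hX cX hzX
  by_cases h : z ∈ Y
  · exact hXZ (eX.trans (key Z hZ cZ (by tauto)).symm)
  · exact hXY (eX.trans (key Y hY cY h).symm)

/-- Union of the tree parts of a set of chords. -/
def U (p : Finset E) : Finset E := p.biUnion s.tp

lemma tp_sub_U {p : Finset E} {a : E} (ha : a ∈ p) : s.tp a ⊆ s.U p :=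
  Finset.subset_biUnion_of_mem s.tp ha

lemma two_card {p : Finset E} (hp : p ⊆ Q) (h : 2 ≤ p.card) : 3 ≤ (s.U p).card := by
  obtain ⟨a, ha, b, hb, hab⟩ := Finset.one_lt_card.1 h
  by_contra hlt
  have h1 := Finset.eq_of_subset_of_card_le (s.tp_sub_U ha)
    (by have := s.tp_card (hp ha); omega)
  have h2 := Finset.eq_of_subset_of_card_le (s.tp_sub_U hb)
    (by have := s.tp_card (hp hb); omega)
  exact s.tp_ne (hp ha) (hp hb) hab (h1.trans h2.symm)

lemma U_card (hk : k ≤ 3) {a : E} (ha : a ∈ Q) : (s.cl a).card + 1 ≤ (s.U (s.cl a)).card := by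
  have hsub : s.cl a ⊆ Q := fun x hx => (s.mem_cl.1 hx).1
  have hle := s.cl_card_le ha
  have hconf : ∀ x ∈ s.cl a, ∀ y ∈ s.cl a, s.Conf x y := fun x hx y hy =>
    s.conf_trans hk (hsub hx) ha (hsub hy) (s.conf_symm (s.mem_cl.1 hx).2) (s.mem_cl.1 hy).2
  have hmem : a ∈ s.cl a := s.mem_cl.2 ⟨ha, s.conf_refl ha⟩
  have hone : 2 ≤ (s.U (s.cl a)).card :=
    (s.tp_card ha).trans (Finset.card_le_card (s.tp_sub_U hmem))
  by_cases h2 : 2 ≤ (s.cl a).card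
  · have h3 := s.two_card hsub h2
    by_cases h4 : (s.cl a).card = 3
    · by_contra hlt
      have hU : (s.U (s.cl a)).card ≤ 3 := by omega
      obtain ⟨x, y, z, hxy, hxz, hyz, hcl⟩ := Finset.card_eq_three.1 h4
      have hx : x ∈ s.cl a := by simp [hcl]
      have hy : y ∈ s.cl a := by simp [hcl]
      have hz : z ∈ s.cl a := by simp [hcl]
      have key : ∀ u ∈ s.cl a, ∀ v ∈ s.cl a, ∀ w ∈ s.cl a, u ≠ v → u ≠ w → v ≠ w →
          ∃ t ∈ s.C u, ¬ (t ∈ s.C v ↔ t ∈ s.C w) := by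
        intro u hu v hv w hw huv huw hvw
        obtain ⟨t, ht, ht'⟩ := three_sets (s.tp_sub_U hu) (s.tp_sub_U hv) (s.tp_sub_U hw) hU
          (s.tp_card (hsub hu)) (s.tp_card (hsub hv)) (s.tp_card (hsub hw))
          (s.tp_ne (hsub hu) (hsub hv) huv) (s.tp_ne (hsub hu) (hsub hw) huw)
          (s.tp_ne (hsub hv) (hsub hw) hvw)
        simp only [tp, Finset.mem_inter] at ht ht'
        exact ⟨t, ht.1, by tauto⟩
      obtain ⟨p, hp, hp'⟩ := hconf x hx y hy
      obtain ⟨q, hq, hq'⟩ := hconf x hx z hz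
      have := s.four_le (hsub hx) (hsub hy) (hsub hz) hxy hxz hyz hp hp' hq hq'
        (key x hx y hy z hz hxy hxz hyz) (key z hz x hx y hy hxz.symm hyz.symm hxy)
        (key y hy x hx z hz hxy.symm hyz hxz)
      omega
    · omega
  · omega

lemma main {T Q : Finset E} {k : ℕ} (s : CycSys T Q k) (hk : k ≤ 3) :
    (k + 1) * Q.card ≤ k * T.card := by
  classical
  have hsub : ∀ a, s.cl a ⊆ Q := fun a x hx => (s.mem_cl.1 hx).1
  set P := Q.image s.cl with hP
  have heq : ∀ a ∈ Q, ∀ b ∈ Q, s.Conf a b → s.cl a = s.cl b := by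
    intro a ha b hb hab
    ext x
    rw [s.mem_cl, s.mem_cl]
    constructor
    · rintro ⟨hx, h⟩
      exact ⟨hx, s.conf_trans hk hb ha hx (s.conf_symm hab) h⟩
    · rintro ⟨hx, h⟩
      exact ⟨hx, s.conf_trans hk ha hb hx hab h⟩
  have hQ : Q.card ≤ ∑ p ∈ P, p.card := by
    have : Q ⊆ P.biUnion id := by
      intro a ha
      rw [Finset.mem_biUnion]
      exact ⟨s.cl a, Finset.mem_image_of_mem _ ha, s.mem_cl.2 ⟨ha, s.conf_refl ha⟩⟩
    exact (Finset.card_le_card this).trans Finset.card_biUnion_le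
  have hT : ∑ p ∈ P, (s.U p).card ≤ T.card := by
    rw [← Finset.card_biUnion]
    · apply Finset.card_le_card
      intro x hx
      simp only [Finset.mem_biUnion, U, tp, Finset.mem_inter] at hx
      tauto
    · intro p hp q hq hpq
      obtain ⟨a, ha, rfl⟩ := Finset.mem_image.1 hp
      obtain ⟨b, hb, rfl⟩ := Finset.mem_image.1 hq
      change Disjoint (s.U (s.cl a)) (s.U (s.cl b))
      rw [Finset.disjoint_left]
      intro x hx hx'
      apply hpq
      simp only [Finset.mem_biUnion, U, tp, Finset.mem_inter, s.mem_cl] at hx hx'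
      obtain ⟨c, ⟨hc, hac⟩, hxc, _⟩ := hx
      obtain ⟨d, ⟨hd, hbd⟩, hxd, _⟩ := hx'
      rw [heq a ha c hc hac, heq b hb d hd hbd]
      exact heq c hc d hd ⟨x, hxc, hxd⟩
  calc (k + 1) * Q.card ≤ (k + 1) * ∑ p ∈ P, p.card := by gcongr
    _ = ∑ p ∈ P, (k + 1) * p.card := by rw [Finset.mul_sum]
    _ ≤ ∑ p ∈ P, k * (s.U p).card := by
        apply Finset.sum_le_sum
        intro p hp
        obtain ⟨a, ha, rfl⟩ := Finset.mem_image.1 hp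
        have h1 := s.cl_card_le ha
        have h2 := s.U_card hk ha
        nlinarith
    _ = k * ∑ p ∈ P, (s.U p).card := by rw [Finset.mul_sum]
    _ ≤ k * T.card := by gcongr

end CycSys

end Abstract

/-! ### The upper bound -/

section Upper

/-- Coboundary of a `ZMod 2` valued function. -/
def dl (f : V → ZMod 2) : Sym2 V → ZMod 2 :=
  Sym2.lift ⟨fun a b => f a + f b, fun a b => add_comm (f a) (f b)⟩

lemma dl_mk (f : V → ZMod 2) (a b : V) : dl f s(a, b) = f a + f b := rfl

lemma walk_sum {G : SimpleGraph V} (f : V → ZMod 2) {u v : V} (w : G.Walk u v) :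
    (w.edges.map (dl f)).sum = f u + f v := by
  induction w with
  | nil => simp [CharTwo.add_self_eq_zero]
  | cons h p ih =>
    rw [Walk.edges_cons, List.map_cons, List.sum_cons, ih, dl_mk]
    rename_i u v w
    have := CharTwo.add_self_eq_zero (f v)
    linear_combination this

/-- Even edge sets of `G`: orthogonal to all cuts. -/
def EvS (G : SimpleGraph V) (S : Finset (Sym2 V)) : Prop :=
  (∀ e ∈ S, e ∈ G.edgeSet) ∧ ∀ f : V → ZMod 2, ∑ e ∈ S, dl f e = 0

variable [DecidableEq V]

/-- Edge sets of cycles of `G`. -/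
def CycS (G : SimpleGraph V) (S : Finset (Sym2 V)) : Prop :=
  ∃ (v : V) (w : G.Walk v v), w.IsCycle ∧ w.edges.toFinset = S

lemma CycS.evS {G : SimpleGraph V} {S : Finset (Sym2 V)} (h : CycS G S) : EvS G S := by
  obtain ⟨v, w, hw, rfl⟩ := h
  refine ⟨fun e he => w.edges_subset_edgeSet (List.mem_toFinset.1 he), fun f => ?_⟩
  rw [List.sum_toFinset _ hw.edges_nodup, walk_sum, CharTwo.add_self_eq_zero]

lemma CycS.card {G : SimpleGraph V} {S : Finset (Sym2 V)} (h : CycS G S) : 3 ≤ S.card := by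
  obtain ⟨v, w, hw, rfl⟩ := h
  rw [List.toFinset_card_of_nodup hw.edges_nodup, Walk.length_edges]
  exact hw.three_le_length

lemma EvS.symmDiff {G : SimpleGraph V} {S S' : Finset (Sym2 V)} (h : EvS G S) (h' : EvS G S') :
    EvS G (symmDiff S S') := by
  refine ⟨fun e he => ?_, fun f => ?_⟩
  · rw [Finset.mem_symmDiff] at he
    rcases he with he | he
    · exact h.1 e he.1
    · exact h'.1 e he.1
  · have h1 := h.2 f
    have h2 := h'.2 f
    have e1 := Finset.sum_inter_add_sum_sdiff S S' (dl f)
    have e2 := Finset.sum_inter_add_sum_sdiff S' S (dl f)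
    rw [Finset.inter_comm] at e2
    have e3 : ∑ e ∈ _root_.symmDiff S S', dl f e
        = ∑ e ∈ S \ S', dl f e + ∑ e ∈ S' \ S, dl f e := by
      rw [← Finset.sum_union (disjoint_sdiff_sdiff)]
      rfl
    have e4 := CharTwo.add_self_eq_zero (∑ e ∈ S ∩ S', dl f e)
    rw [e3]
    linear_combination e1 + e2 + h1 + h2 - e4

lemma EvS.exists_cycle {G : SimpleGraph V} {S : Finset (Sym2 V)} (h : EvS G S) {e : Sym2 V}
    (he : e ∈ S) : ∃ D, D ⊆ S ∧ e ∈ D ∧ CycS G D := by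
  classical
  induction e with
  | _ a b =>
  set H : SimpleGraph V := fromEdgeSet (S : Set (Sym2 V)) with hH
  have hHadj : ∀ x y, H.Adj x y ↔ s(x, y) ∈ S := by
    intro x y
    rw [hH, fromEdgeSet_adj]
    refine ⟨fun h => h.1, fun h1 => ⟨h1, ?_⟩⟩
    exact G.ne_of_adj (h.1 _ h1)
  have hHG : H ≤ G := fun x y hxy => h.1 _ ((hHadj x y).1 hxy)
  have hreach : (H.deleteEdges {s(a, b)}).Reachable a b := by
    by_contra hn
    set f : V → ZMod 2 := fun x => if (H.deleteEdges {s(a, b)}).Reachable a x then 1 else 0 with hf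
    have hsum := h.2 f
    rw [← Finset.add_sum_erase _ _ he, Finset.sum_eq_zero, dl_mk] at hsum
    · simp [hf, hn] at hsum
    · intro e' he'
      induction e' with
      | _ x y =>
      rw [Finset.mem_erase] at he'
      have hadj : (H.deleteEdges {s(a, b)}).Adj x y := by
        rw [deleteEdges_adj]
        exact ⟨(hHadj x y).2 he'.2, by simpa using he'.1⟩
      have hiff : (H.deleteEdges {s(a, b)}).Reachable a x ↔
          (H.deleteEdges {s(a, b)}).Reachable a y :=
        ⟨fun h => h.trans hadj.reachable, fun h => h.trans hadj.symm.reachable⟩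
      rw [dl_mk]
      simp only [hf, hiff]
      exact CharTwo.add_self_eq_zero _
  obtain ⟨u, p, hp, hab⟩ := adj_and_reachable_delete_edges_iff_exists_cycle.1
    ⟨(hHadj a b).2 he, hreach⟩
  refine ⟨p.edges.toFinset, ?_, by simpa using hab, u, p.mapLe hHG, hp.mapLe hHG, ?_⟩
  · intro x hx
    have := p.edges_subset_edgeSet (List.mem_toFinset.1 hx)
    induction x with
    | _ x y => exact (hHadj x y).1 this
  · simp

lemma upper [Fintype V] {G : SimpleGraph V} {k : ℕ} (hk : k ≤ 3) (hG : IsKCactus G k) :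
    ∃ m, G.edgeSet.ncard = (Fintype.card V - 1) + m ∧ (k + 1) * m ≤ k * (Fintype.card V - 1) := by
  classical
  obtain ⟨T, hTG, hT⟩ := hG.1.exists_isTree_le
  have hTc := hT.card_edgeFinset
  have hfund : ∀ e : Sym2 V, e ∈ G.edgeFinset \ T.edgeFinset →
      ∃ C, CycS G C ∧ e ∈ C ∧ ∀ x ∈ C, x ∈ T.edgeFinset ∨ x = e := by
    intro e he
    induction e with
    | _ a b =>
    rw [Finset.mem_sdiff, mem_edgeFinset, mem_edgeFinset, mem_edgeSet, mem_edgeSet] at he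
    set H := T ⊔ fromEdgeSet {s(a, b)} with hH
    have hHG : H ≤ G := by
      refine sup_le hTG ?_
      intro x y hxy
      rw [fromEdgeSet_adj] at hxy
      have h1 : s(x, y) = s(a, b) := hxy.1
      rw [← mem_edgeSet, h1]
      exact he.1
    have hTH : T ≤ H.deleteEdges {s(a, b)} := by
      intro x y hxy
      rw [deleteEdges_adj]
      refine ⟨Or.inl hxy, ?_⟩
      intro h1
      have h1 : s(x, y) = s(a, b) := h1
      rw [← mem_edgeSet, h1] at hxy
      exact he.2 hxy
    have hHab : H.Adj a b := by
      right
      rw [fromEdgeSet_adj]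
      exact ⟨rfl, he.1.ne⟩
    obtain ⟨u, p, hp, hab⟩ := adj_and_reachable_delete_edges_iff_exists_cycle.1
      ⟨hHab, (hT.connected a b).mono hTH⟩
    refine ⟨p.edges.toFinset, ⟨u, p.mapLe hHG, hp.mapLe hHG, by simp⟩, by simpa using hab, ?_⟩
    intro x hx
    have hx' := p.edges_subset_edgeSet (List.mem_toFinset.1 hx)
    induction x with
    | _ x y =>
    rw [mem_edgeSet, hH, sup_adj, fromEdgeSet_adj] at hx'
    rcases hx' with h | h
    · left; simpa using h
    · right; exact h.1
  choose! C hC1 hC2 hC3 using hfund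
  have hnoT : ∀ D, CycS G D → ¬ D ⊆ T.edgeFinset := by
    rintro D ⟨v, w, hw, rfl⟩ hsub
    have hmem : ∀ e ∈ w.edges, e ∈ T.edgeSet := fun e he => by
      have := hsub (List.mem_toFinset.2 he)
      rwa [mem_edgeFinset] at this
    exact hT.isAcyclic (w.transfer T hmem) (hw.transfer hmem)
  let s : CycSys T.edgeFinset (G.edgeFinset \ T.edgeFinset) k :=
    { Cyc := CycS G
      Ev := EvS G
      C := C
      disj := fun a ha => (Finset.mem_sdiff.1 ha).2
      ev_symm := fun S S' h h' => h.symmDiff h'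
      uniq := by
        intro S S' h h' hx
        by_contra hne
        have hev := h.symmDiff h'
        have hnem : (symmDiff S S').Nonempty := by
          rw [Finset.nonempty_iff_ne_empty]
          intro h0
          exact hne (symmDiff_eq_bot.1 h0)
        obtain ⟨e, he⟩ := hnem
        obtain ⟨D, hDS, _, hD⟩ := hev.exists_cycle he
        refine hnoT D hD fun x hxD => ?_
        by_contra hxT
        have h1 := hDS hxD
        rw [Finset.mem_symmDiff, hx x hxT] at h1
        tauto
      cyc_ev := fun S h => h.evS
      cyc_card := fun S h => h.card
      ev_cyc := fun S a h ha => h.exists_cycle ha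
      bound := by
        intro a F hF
        rcases F.eq_empty_or_nonempty with rfl | ⟨D0, hD0⟩
        · simp
        have haG : a ∈ G.edgeSet := (hF D0 hD0).1.evS.1 a (hF D0 hD0).2
        refine le_trans ?_ (hG.2 a haG)
        have hsub : ((fun D : Finset (Sym2 V) => (D : Set (Sym2 V))) '' (F : Set (Finset (Sym2 V)))) ⊆
            (fun X : G.Subgraph => X.edgeSet) '' CyclesThrough G a := by
          intro X hX
          obtain ⟨D, hD, rfl⟩ := hX
          obtain ⟨⟨v, w, hw, hwD⟩, haD⟩ := hF D hD
          have hes : w.toSubgraph.edgeSet = (D : Set (Sym2 V)) := by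
            ext e
            rw [Walk.mem_edges_toSubgraph, ← hwD]
            simp
          refine ⟨w.toSubgraph, ⟨⟨v, w, hw, rfl⟩, ?_⟩, hes⟩
          rw [hes]
          exact haD
        have h1 := Set.ncard_le_ncard hsub (Set.toFinite _)
        rw [Set.ncard_image_of_injective _ Finset.coe_injective, Set.ncard_coe_finset] at h1
        exact h1.trans (Set.ncard_image_le (Set.toFinite _))
      C_cyc := hC1
      C_mem := hC2
      C_sub := hC3 }
  have hmain := s.main hk
  refine ⟨(G.edgeFinset \ T.edgeFinset).card, ?_, ?_⟩
  · have hsub : T.edgeFinset ⊆ G.edgeFinset := edgeFinset_subset_edgeFinset.2 hTG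
    have h1 := Finset.card_sdiff_add_card_eq_card hsub
    rw [← coe_edgeFinset, Set.ncard_coe_finset]
    omega
  · rw [← hTc]
    simpa using hmain

end Upper

/-! ### The construction -/

section Construction

/-- All vertices are joined to the hub `z`, and every vertex to the head of its block. -/
def hubGraph (z : V) (hd : V → V) : SimpleGraph V where
  Adj u v := u ≠ v ∧ (u = z ∨ v = z ∨ hd v = u ∨ hd u = v)
  symm := ⟨fun u v h => ⟨h.1.symm, by tauto⟩⟩
  loopless := ⟨fun u h => h.1 rfl⟩

lemma hubGraph_adj {z : V} {hd : V → V} {u v : V} : (hubGraph z hd).Adj u v ↔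
    u ≠ v ∧ (u = z ∨ v = z ∨ hd v = u ∨ hd u = v) := Iff.rfl

/-- A subgraph all of whose vertices have degree two. -/
structure TwoReg {G : SimpleGraph V} (D : G.Subgraph) : Prop where
  other : ∀ v x, D.Adj v x → ∃ y, y ≠ x ∧ D.Adj v y
  le_two : ∀ v x y t, D.Adj v x → D.Adj v y → D.Adj v t → x = y ∨ x = t ∨ y = t
  verts : ∀ v ∈ D.verts, ∃ x, D.Adj v x

lemma IsCycleSub.twoReg {G : SimpleGraph V} {D : G.Subgraph} (h : IsCycleSub G D) : TwoReg D := by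
  obtain ⟨a, w, hw, rfl⟩ := h
  have key : ∀ v ∈ w.toSubgraph.verts, ∃ x y, x ≠ y ∧ w.toSubgraph.neighborSet v = {x, y} := by
    intro v hv
    exact Set.ncard_eq_two.1
      (hw.ncard_neighborSet_toSubgraph_eq_two (w.mem_verts_toSubgraph.1 hv))
  have key2 : ∀ v ∈ w.toSubgraph.verts, ∃ x y, x ≠ y ∧
      ∀ t, w.toSubgraph.Adj v t ↔ t = x ∨ t = y := by
    intro v hv
    obtain ⟨x, y, hxy, h⟩ := key v hv
    refine ⟨x, y, hxy, fun t => ?_⟩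
    rw [← Subgraph.mem_neighborSet, h]
    simp
  refine ⟨?_, ?_, ?_⟩
  · intro v x hx
    obtain ⟨p, q, hpq, h⟩ := key2 v (w.toSubgraph.edge_vert hx)
    rw [h] at hx
    rcases hx with rfl | rfl
    · exact ⟨q, hpq.symm, (h q).2 (Or.inr rfl)⟩
    · exact ⟨p, hpq, (h p).2 (Or.inl rfl)⟩
  · intro v x y t hx hy ht
    obtain ⟨p, q, hpq, h⟩ := key2 v (w.toSubgraph.edge_vert hx)
    rw [h] at hx hy ht
    grind
  · intro v hv
    obtain ⟨p, q, hpq, h⟩ := key2 v hv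
    exact ⟨p, (h p).2 (Or.inl rfl)⟩

variable {z : V} {hd : V → V}

lemma hub_L1 (hidem : ∀ j, hd (hd j) = hd j) {D : (hubGraph z hd).Subgraph} (hD : TwoReg D)
    {j x : V} (hj : j ≠ z) (hh : hd j ≠ j) (hx : D.Adj j x) : D.Adj z j ∧ D.Adj j (hd j) := by
  have nb : ∀ y, D.Adj j y → y = z ∨ y = hd j := by
    intro y hy
    have h1 := hubGraph_adj.1 (D.adj_sub hy)
    rcases h1 with ⟨h0, h1 | h1 | h1 | h1⟩
    · exact absurd h1 hj
    · exact Or.inl h1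
    · exact absurd (by rw [← h1, hidem]) hh
    · exact Or.inr h1.symm
  obtain ⟨y, hyx, hy⟩ := hD.other j x hx
  rcases nb x hx with rfl | rfl <;> rcases nb y hy with rfl | rfl
  · exact absurd rfl hyx
  · exact ⟨hx.symm, hy⟩
  · exact ⟨hy.symm, hx⟩
  · exact absurd rfl hyx

lemma hub_L2 (hidem : ∀ j, hd (hd j) = hd j) (hz : ∀ j, hd j = z → j = z)
    {D : (hubGraph z hd).Subgraph} (hD : TwoReg D)
    {x : V} (hx : D.Adj z x) : ∃ y, y ≠ x ∧ D.Adj z y ∧ hd y = hd x := by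
  have hxz : x ≠ z := hx.ne.symm
  have hhz : hd x ≠ z := fun h => hxz (hz x h)
  have aux : ∀ y, y ≠ z → D.Adj (hd x) y → D.Adj z y ∧ hd y = hd x := by
    intro y hyz hy
    have h1 := hubGraph_adj.1 (D.adj_sub hy)
    rcases h1 with ⟨h0, h1 | h1 | h1 | h1⟩
    · exact absurd h1 hhz
    · exact absurd h1 hyz
    · exact ⟨(hub_L1 hidem hD hyz (by rw [h1]; exact h0) hy.symm).1, h1⟩
    · rw [hidem] at h1
      exact absurd h1 h0
  by_cases hh : hd x = x
  · obtain ⟨y, hyz, hy⟩ := hD.other x z hx.symm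
    have := aux y hyz (by rw [hh]; exact hy)
    exact ⟨y, hy.ne.symm, this⟩
  · have h1 := hub_L1 hidem hD hxz hh hx.symm
    obtain ⟨y, hyx, hy⟩ := hD.other (hd x) x h1.2.symm
    by_cases hyz : y = z
    · subst hyz
      exact ⟨hd x, hh, hy.symm, hidem x⟩
    · exact ⟨y, hyx, aux y hyz hy⟩

lemma hub_L3 (hidem : ∀ j, hd (hd j) = hd j)
    {D : (hubGraph z hd).Subgraph} (hD : TwoReg D) (u v : V) :
    D.Adj u v ↔ u ≠ v ∧ ((u = z ∧ D.Adj z v) ∨ (v = z ∧ D.Adj z u) ∨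
      (u ≠ z ∧ v ≠ z ∧ hd v = u ∧ D.Adj z v) ∨ (u ≠ z ∧ v ≠ z ∧ hd u = v ∧ D.Adj z u)) := by
  constructor
  · intro h
    have hne := h.ne
    refine ⟨hne, ?_⟩
    by_cases hu : u = z
    · subst hu; exact Or.inl ⟨rfl, h⟩
    by_cases hv : v = z
    · subst hv; exact Or.inr (Or.inl ⟨rfl, h.symm⟩)
    rcases hubGraph_adj.1 (D.adj_sub h) with ⟨h0, h1 | h1 | h1 | h1⟩
    · exact absurd h1 hu
    · exact absurd h1 hv
    · exact Or.inr (Or.inr (Or.inl ⟨hu, hv, h1, (hub_L1 hidem hD hv (by rw [h1]; exact h0) h.symm).1⟩))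
    · exact Or.inr (Or.inr (Or.inr ⟨hu, hv, h1,
        (hub_L1 hidem hD hu (by rw [h1]; exact h0.symm) h).1⟩))
  · rintro ⟨hne, ⟨rfl, h⟩ | ⟨rfl, h⟩ | ⟨hu, hv, rfl, h⟩ | ⟨hu, hv, rfl, h⟩⟩
    · exact h
    · exact h.symm
    · exact (hub_L1 hidem hD hv hne h.symm).2.symm
    · exact (hub_L1 hidem hD hu hne.symm h.symm).2

lemma hub_cactus [Finite V] (k : ℕ) (hidem : ∀ j, hd (hd j) = hd j) (hz : ∀ j, hd j = z → j = z)
    (hcard : ∀ x, x ≠ z → {i | i ≠ z ∧ hd i = hd x}.ncard ≤ k + 1) :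
    IsKCactus (hubGraph z hd) k := by
  constructor
  · rw [connected_iff_exists_forall_reachable]
    refine ⟨z, fun w => ?_⟩
    by_cases h : z = w
    · subst h; exact Reachable.refl _
    · exact Adj.reachable (hubGraph_adj.2 ⟨h, Or.inl rfl⟩)
  · intro e he
    have hex : ∃ x, x ≠ z ∧ ∀ D ∈ CyclesThrough (hubGraph z hd) e, D.Adj z x := by
      induction e with
      | _ u v =>
      have h2 : ∀ D ∈ CyclesThrough (hubGraph z hd) s(u, v), TwoReg D ∧ D.Adj u v :=
        fun D hD => ⟨hD.1.twoReg, hD.2⟩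
      have hne : u ≠ v := he.1
      by_cases hu : u = z
      · subst hu; exact ⟨v, hne.symm, fun D hD => (h2 D hD).2⟩
      by_cases hv : v = z
      · subst hv; exact ⟨u, hne, fun D hD => (h2 D hD).2.symm⟩
      rcases hubGraph_adj.1 he with ⟨h0, h1 | h1 | h1 | h1⟩
      · exact absurd h1 hu
      · exact absurd h1 hv
      · exact ⟨v, hv, fun D hD => (hub_L1 hidem (h2 D hD).1 hv (by rw [h1]; exact h0)
          (h2 D hD).2.symm).1⟩
      · exact ⟨u, hu, fun D hD => (hub_L1 hidem (h2 D hD).1 hu (by rw [h1]; exact h0.symm)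
          (h2 D hD).2).1⟩
    obtain ⟨x, hxz, hx⟩ := hex
    set B : Set V := {i | i ≠ z ∧ hd i = hd x} with hB
    have hxB : x ∈ B := ⟨hxz, rfl⟩
    have hBx : (B \ {x}).ncard ≤ k := by
      have h1 := Set.ncard_diff_singleton_add_one hxB (Set.toFinite _)
      have h2 := hcard x hxz
      rw [← hB] at h2
      omega
    refine le_trans ?_ hBx
    refine le_trans ?_ (Set.ncard_image_le (f := fun y => ({x, y} : Set V)) (Set.toFinite (B \ {x})))
    refine Set.ncard_le_ncard_of_injOn (fun D => {t | D.Adj z t}) ?_ ?_ (Set.toFinite _)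
    · intro D hD
      have hreg := hD.1.twoReg
      have hDx := hx D hD
      obtain ⟨y, hyx, hy, hyd⟩ := hub_L2 hidem hz hreg hDx
      refine ⟨y, ⟨⟨hy.ne.symm, hyd⟩, hyx⟩, ?_⟩
      ext t
      simp only [Set.mem_insert_iff, Set.mem_singleton_iff, Set.mem_setOf_eq]
      constructor
      · rintro (rfl | rfl)
        · exact hDx
        · exact hy
      · intro ht
        have := hreg.le_two z x y t hDx hy ht
        grind
    · intro D hD D' hD' heq
      have hreg := hD.1.twoReg
      have hreg' := hD'.1.twoReg
      have hN : ∀ t, D.Adj z t ↔ D'.Adj z t := fun t => Set.ext_iff.1 heq t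
      have hA : ∀ u v, D.Adj u v ↔ D'.Adj u v := by
        intro u v
        rw [hub_L3 hidem hreg, hub_L3 hidem hreg', hN, hN]
      apply Subgraph.ext
      · ext v
        constructor
        · intro hv
          obtain ⟨t, ht⟩ := hreg.verts v hv
          exact D'.edge_vert ((hA _ _).1 ht)
        · intro hv
          obtain ⟨t, ht⟩ := hreg'.verts v hv
          exact D.edge_vert ((hA _ _).2 ht)
      · ext u v
        exact hA u v

lemma hub_edges [Finite V] (hidem : ∀ j, hd (hd j) = hd j) (hz : ∀ j, hd j = z → j = z) :
    (hubGraph z hd).edgeSet.ncard = {j | j ≠ z}.ncard + {j | j ≠ z ∧ hd j ≠ j}.ncard := by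
  have hset : (hubGraph z hd).edgeSet = (fun j => s(z, j)) '' {j | j ≠ z} ∪
      (fun j => s(hd j, j)) '' {j | j ≠ z ∧ hd j ≠ j} := by
    ext e
    induction e with
    | _ u v =>
    rw [mem_edgeSet, hubGraph_adj]
    constructor
    · rintro ⟨hne, h⟩
      by_cases hu : u = z
      · subst hu; exact Or.inl ⟨v, hne.symm, rfl⟩
      by_cases hv : v = z
      · subst hv; exact Or.inl ⟨u, hne, Sym2.eq_swap⟩
      rcases h with h | h | h | h
      · exact absurd h hu
      · exact absurd h hv
      · subst h; exact Or.inr ⟨v, ⟨hv, hne⟩, rfl⟩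
      · subst h; exact Or.inr ⟨u, ⟨hu, hne.symm⟩, Sym2.eq_swap⟩
    · rintro (⟨j, hj, h⟩ | ⟨j, ⟨hj, hj'⟩, h⟩)
      · have hj : j ≠ z := hj
        simp only [Sym2.eq_iff] at h
        rcases h with ⟨rfl, rfl⟩ | ⟨rfl, rfl⟩
        · exact ⟨hj.symm, Or.inl rfl⟩
        · exact ⟨hj, Or.inr (Or.inl rfl)⟩
      · simp only [Sym2.eq_iff] at h
        rcases h with ⟨rfl, rfl⟩ | ⟨rfl, rfl⟩
        · exact ⟨hj', by tauto⟩
        · exact ⟨hj'.symm, by tauto⟩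
  rw [hset, Set.ncard_union_eq _ (Set.toFinite _) (Set.toFinite _), Set.ncard_image_of_injOn,
    Set.ncard_image_of_injOn]
  · rintro i ⟨hi, hi'⟩ j ⟨hj, hj'⟩ h
    simp only [Sym2.eq_iff] at h
    rcases h with ⟨_, h⟩ | ⟨h1, h2⟩
    · exact h
    · exact absurd (by rw [← h1, hidem]) hj'
  · intro i hi j hj h
    simp only [Sym2.eq_iff] at h
    rcases h with ⟨_, h⟩ | ⟨h1, h2⟩
    · exact h
    · exact h2.trans h1
  · rw [Set.disjoint_left]
    rintro e ⟨i, hi, rfl⟩ ⟨j, ⟨hj, hj'⟩, h⟩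
    simp only [Sym2.eq_iff] at h
    rcases h with ⟨h, _⟩ | ⟨_, h⟩
    · exact hj (hz j h)
    · exact hj h

lemma construct (k m : ℕ) (hcount : ((Finset.range (m + 1)).filter
      (fun j => j ≠ 0 ∧ (j - 1) % (k + 1) ≠ 0)).card = k * m / (k + 1)) :
    ∃ G : SimpleGraph (Fin (m + 1)), IsKCactus G k ∧ G.edgeSet.ncard = m + k * m / (k + 1) := by
  set hd : Fin (m + 1) → Fin (m + 1) := fun j => ⟨j.1 - (j.1 - 1) % (k + 1), by omega⟩ with hhd
  have hlt : ∀ j : ℕ, (j - 1) % (k + 1) < k + 1 := fun j => Nat.mod_lt _ (Nat.succ_pos k)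
  have hle : ∀ j : ℕ, (j - 1) % (k + 1) ≤ j - 1 := fun j => Nat.mod_le _ _
  have hidem : ∀ j, hd (hd j) = hd j := by
    intro j
    apply Fin.ext
    simp only [hhd]
    have : (j.1 - (j.1 - 1) % (k + 1) - 1) % (k + 1) = 0 := by
      have h1 : j.1 - (j.1 - 1) % (k + 1) - 1 = (j.1 - 1) - (j.1 - 1) % (k + 1) := by omega
      rw [h1]
      exact Nat.sub_mod_eq_zero_of_mod_eq (by simp)
    omega
  have hz : ∀ j, hd j = 0 → j = 0 := by
    intro j h
    have h1 := Fin.ext_iff.1 h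
    simp only [hhd, Fin.val_zero] at h1
    have h2 := hle j.1
    apply Fin.ext
    simp only [Fin.val_zero]
    omega
  refine ⟨hubGraph 0 hd, hub_cactus k hidem hz ?_, ?_⟩
  · intro x hx
    rw [← Set.ncard_image_of_injective _ Fin.val_injective]
    have hsub : Fin.val '' {i | i ≠ 0 ∧ hd i = hd x} ⊆
        (Finset.Icc (hd x).1 ((hd x).1 + k) : Set ℕ) := by
      rintro _ ⟨i, ⟨hi, hix⟩, rfl⟩
      rw [← hix]
      simp only [hhd, Finset.coe_Icc, Set.mem_Icc]
      have := hlt i.1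
      omega
    have h1 := Set.ncard_le_ncard hsub (Set.toFinite _)
    rw [Set.ncard_coe_finset, Nat.card_Icc] at h1
    omega
  · rw [hub_edges hidem hz, ← hcount]
    congr 1
    · have := Set.ncard_add_ncard_compl ({0} : Set (Fin (m + 1)))
      rw [Set.ncard_singleton, Nat.card_eq_fintype_card, Fintype.card_fin] at this
      have h2 : {j : Fin (m + 1) | j ≠ 0} = {0}ᶜ := by ext; simp
      rw [h2]
      omega
    · rw [← Set.ncard_image_of_injective _ Fin.val_injective, ← Set.ncard_coe_finset]
      congr 1
      ext j
      simp only [Set.mem_image, Set.mem_setOf_eq, Finset.coe_filter, Finset.mem_range]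
      constructor
      · rintro ⟨i, ⟨hi, hi'⟩, rfl⟩
        refine ⟨i.2, fun h => hi (Fin.ext h), fun h => hi' (Fin.ext ?_)⟩
        simp only [hhd]
        omega
      · rintro ⟨h1, h2, h3⟩
        refine ⟨⟨j, h1⟩, ⟨fun h => h2 (Fin.ext_iff.1 h), fun h => ?_⟩, rfl⟩
        have h4 := Fin.ext_iff.1 h
        simp only [hhd] at h4
        omega

end Construction

/-- Every 2-cactus with `n` vertices has at most `⌊5(n-1)/3⌋` edges and every
3-cactus with `n` vertices has at most `⌊7(n-1)/4⌋` edges; both bounds are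
attained for every `n ≥ 1`. -/
theorem two_three_cactus_size :
    (∀ (V : Type) [Fintype V] (G : SimpleGraph V), IsKCactus G 2 →
      G.edgeSet.ncard ≤ 5 * (Fintype.card V - 1) / 3) ∧
    (∀ (V : Type) [Fintype V] (G : SimpleGraph V), IsKCactus G 3 →
      G.edgeSet.ncard ≤ 7 * (Fintype.card V - 1) / 4) ∧
    (∀ n : ℕ, 1 ≤ n → ∃ G : SimpleGraph (Fin n), IsKCactus G 2 ∧
      G.edgeSet.ncard = 5 * (n - 1) / 3) ∧
    (∀ n : ℕ, 1 ≤ n → ∃ G : SimpleGraph (Fin n), IsKCactus G 3 ∧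
      G.edgeSet.ncard = 7 * (n - 1) / 4) := by
  refine ⟨?_, ?_, ?_, ?_⟩
  · intro V _ G hG
    classical
    obtain ⟨m, h1, h2⟩ := upper (by norm_num) hG
    omega
  · intro V _ G hG
    classical
    obtain ⟨m, h1, h2⟩ := upper (by norm_num) hG
    omega
  · intro n hn
    obtain ⟨m, rfl⟩ : ∃ m, n = m + 1 := ⟨n - 1, by omega⟩
    obtain ⟨G, h1, h2⟩ := construct 2 m (by
      induction m with
      | zero => rfl
      | succ m ih =>
        have ih := ih (by omega)
        rw [Finset.range_add_one, Finset.filter_insert]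
        split_ifs with h
        · rw [Finset.card_insert_of_notMem (by simp), ih]
          have hm : m % 3 = 0 ∨ m % 3 = 1 ∨ m % 3 = 2 := by omega
          obtain ⟨q, hq⟩ : ∃ q, m = 3 * q + m % 3 := ⟨m / 3, by omega⟩
          rcases hm with hm | hm | hm <;> rw [hm] at hq <;> subst hq <;> omega
        · rw [ih]
          omega)
    exact ⟨G, h1, by omega⟩
  · intro n hn
    obtain ⟨m, rfl⟩ : ∃ m, n = m + 1 := ⟨n - 1, by omega⟩
    obtain ⟨G, h1, h2⟩ := construct 3 m (by
      induction m with
      | zero => rfl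
      | succ m ih =>
        have ih := ih (by omega)
        rw [Finset.range_add_one, Finset.filter_insert]
        split_ifs with h
        · rw [Finset.card_insert_of_notMem (by simp), ih]
          have hm : m % 4 = 0 ∨ m % 4 = 1 ∨ m % 4 = 2 ∨ m % 4 = 3 := by omega
          obtain ⟨q, hq⟩ : ∃ q, m = 4 * q + m % 4 := ⟨m / 4, by omega⟩
          rcases hm with hm | hm | hm | hm <;> rw [hm] at hq <;> subst hq <;> omega
        · rw [ih]
          omega)
    exact ⟨G, h1, by omega⟩
end

section
/- Every 4-cactus graph with n vertices has at most 2n - 2 edges if n ≡ 1 (mod 3), and at most 2n - 3 edges otherwise; these bounds are tight (attained by coalescing copies of K_4 at a common vertex, plus one extra K_3 or K_2 block depending on the residue of n mod 3). -/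
open SimpleGraph

variable {V : Type}

/-- `l` is the vertex list of a path from `x` to `y`. -/
def LP {V : Type} (G : SimpleGraph V) (x y : V) (l : List V) : Prop :=
  l.head? = some x ∧ l.getLast? = some y ∧ l.Nodup ∧ l.IsChain G.Adj

/-- There are five distinct lists satisfying `P`. -/
def Five {V : Type} (P : List V → Prop) : Prop :=
  ∃ L : List (List V), L.length = 5 ∧ L.Nodup ∧ ∀ l ∈ L, P l

theorem LP.exists_walk {V : Type} {G : SimpleGraph V} {x y : V} {l : List V} (h : LP G x y l) :
    ∃ p : G.Walk x y, p.IsPath ∧ p.support = l := by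
  obtain ⟨h1, h2, h3, h4⟩ := h
  have hne : l ≠ [] := by rintro rfl; simp at h1
  have e1 : l.head hne = x := by
    rw [List.head?_eq_some_head hne] at h1; simpa using h1
  have e2 : l.getLast hne = y := by
    rw [List.getLast?_eq_some_getLast hne] at h2; simpa using h2
  subst e1 e2
  refine ⟨Walk.ofSupport l hne h4, ?_, Walk.support_ofSupport hne h4⟩
  rw [Walk.isPath_def, Walk.support_ofSupport]; exact h3

theorem path_eq_of_edges {V : Type} {G : SimpleGraph V} {u v : V} (p q : G.Walk u v)
    (hp : p.IsPath) (hq : q.IsPath) (h : ∀ e, e ∈ p.edges ↔ e ∈ q.edges) : p = q := by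
  induction p with
  | nil => exact (Walk.isPath_iff_nil.1 hq).eq_nil.symm
  | @cons u a w ha p ih =>
    cases q with
    | nil => simp at hp
    | @cons _ b _ hb q =>
      rw [Walk.cons_isPath_iff] at hp hq
      have h1 : s(u, a) ∉ p.edges := fun hh => hp.2 (p.fst_mem_support_of_mem_edges hh)
      have h2 : ∀ c, s(u, c) ∉ q.edges := fun c hh => hq.2 (q.fst_mem_support_of_mem_edges hh)
      have h3 : ∀ c, s(u, c) ∉ p.edges := fun c hh => hp.2 (p.fst_mem_support_of_mem_edges hh)
      have hab : a = b := by
        have := (h s(u, a)).1 (by simp)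
        rw [Walk.edges_cons, List.mem_cons] at this
        rcases this with h' | h'
        · have hne := ha.ne
          have : a = b ∨ u = b ∧ a = u := by simpa using h'
          grind
        · exact absurd h' (h2 a)
      subst hab
      congr 1
      apply ih q hp.1 hq.1
      intro e
      have := h e
      rw [Walk.edges_cons, Walk.edges_cons, List.mem_cons, List.mem_cons] at this
      by_cases he : e = s(u, a)
      · subst he; simp [h1, h2]
      · simpa [he] using this

theorem path_edge_ends {V : Type} {G : SimpleGraph V} {x y : V} (p : G.Walk x y)
    (hp : p.IsPath) (hl : 3 ≤ p.support.length) : s(y, x) ∉ p.edges := by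
  intro he
  cases p with
  | nil => simp at he
  | @cons _ b _ hb p =>
    rw [Walk.cons_isPath_iff] at hp
    rw [Walk.edges_cons, List.mem_cons] at he
    rcases he with h' | h'
    · have : y = b := by
        have hne := hb.ne
        rw [Sym2.eq_swap] at h'
        have : y = b ∨ x = b ∧ y = x := by simpa using h'
        grind
      subst this
      have := (Walk.isPath_iff_nil.1 hp.1).eq_nil
      subst this
      simp at hl
    · exact hp.2 (p.snd_mem_support_of_mem_edges h')

theorem noFive {V : Type} [Finite V] {G : SimpleGraph V} (hG : IsKCactus G 4) {x y : V}
    (h : G.Adj x y) : ¬ Five (fun l => LP G x y l ∧ 3 ≤ l.length) := by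
  classical
  rintro ⟨L, hL5, hLn, hL⟩
  have hex : ∀ l ∈ L, ∃ p : G.Walk x y, p.IsPath ∧ p.support = l := fun l hl => (hL l hl).1.exists_walk
  have : Nonempty (G.Walk x y) := ⟨Walk.cons h Walk.nil⟩
  choose! f hf using hex
  have hcyc := hG.2 s(x, y) h
  let F : List V → G.Subgraph := fun l => (Walk.cons h.symm (f l)).toSubgraph
  have hsub : F '' (L.toFinset : Set (List V)) ⊆ CyclesThrough G s(x, y) := by
    rintro _ ⟨l, hl, rfl⟩
    have hl : l ∈ L := by simpa using hl
    refine ⟨⟨y, Walk.cons h.symm (f l), ?_, rfl⟩, ?_⟩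
    · rw [Walk.cons_isCycle_iff]
      refine ⟨(hf l hl).1, path_edge_ends _ (hf l hl).1 ?_⟩
      rw [(hf l hl).2]; exact (hL l hl).2
    · rw [Walk.mem_edges_toSubgraph]; simp [Sym2.eq_swap]
  have hinj : Set.InjOn F (L.toFinset : Set (List V)) := by
    intro l hl m hm hlm
    have hl : l ∈ L := by simpa using hl
    have hm : m ∈ L := by simpa using hm
    have : f l = f m := by
      apply path_eq_of_edges _ _ (hf l hl).1 (hf m hm).1
      intro e
      have h1 : s(y, x) ∉ (f l).edges := by
        apply path_edge_ends _ (hf l hl).1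
        rw [(hf l hl).2]; exact (hL l hl).2
      have h2 : s(y, x) ∉ (f m).edges := by
        apply path_edge_ends _ (hf m hm).1
        rw [(hf m hm).2]; exact (hL m hm).2
      have h3 : e ∈ (F l).edgeSet ↔ e ∈ (F m).edgeSet := by rw [hlm]
      simp only [F] at h3
      rw [Walk.mem_edges_toSubgraph, Walk.mem_edges_toSubgraph, Walk.edges_cons, Walk.edges_cons,
        List.mem_cons, List.mem_cons] at h3
      by_cases he : e = s(y, x)
      · subst he; simp [h1, h2]
      · simpa [he] using h3
    rw [← (hf l hl).2, ← (hf m hm).2, this]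
  have := Set.ncard_le_ncard hsub (Set.toFinite _)
  rw [hinj.ncard_image, Set.ncard_coe_finset, List.toFinset_card_of_nodup hLn] at this
  omega


theorem LP.append {V : Type} {G : SimpleGraph V} {x y u v : V} {l m : List V}
    (hl : LP G x y l) (hm : LP G u v m) (h : G.Adj y u) (hd : ∀ t ∈ l, t ∉ m) :
    LP G x v (l ++ m) := by
  obtain ⟨h1, h2, h3, h4⟩ := hl
  obtain ⟨k1, k2, k3, k4⟩ := hm
  refine ⟨by simp [List.head?_append, h1], by simp [List.getLast?_append, k2], ?_, ?_⟩
  · rw [List.nodup_append]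
    exact ⟨h3, k3, fun a ha b hb hab => hd a ha (hab ▸ hb)⟩
  · rw [List.isChain_append]
    refine ⟨h4, k4, ?_⟩
    intro a ha b hb
    rw [h2] at ha; rw [k1] at hb
    simp at ha hb
    subst ha hb; exact h

theorem LP.rev {V : Type} {G : SimpleGraph V} {x y : V} {l : List V}
    (hl : LP G x y l) : LP G y x l.reverse := by
  obtain ⟨h1, h2, h3, h4⟩ := hl
  refine ⟨by simp [h2], by simp [h1], by simpa using h3, ?_⟩
  rw [List.isChain_reverse]
  exact h4.imp fun a b h => h.symm

theorem LP.single {V : Type} (G : SimpleGraph V) (x : V) : LP G x x [x] := by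
  simp [LP]

theorem LP.map' {V : Type} {G : SimpleGraph V} {p : ℕ → V} {j x y : ℕ} {l : List ℕ}
    (hinj : ∀ s t, s ≤ j → t ≤ j → p s = p t → s = t)
    (h : LP (G.comap p) x y l) (hj : ∀ t ∈ l, t ≤ j) : LP G (p x) (p y) (l.map p) := by
  obtain ⟨h1, h2, h3, h4⟩ := h
  refine ⟨by simp [h1], by simp [h2], ?_, ?_⟩
  · exact List.Nodup.map_on (fun a ha b hb hab => hinj a b (hj a ha) (hj b hb) hab) h3
  · rw [List.isChain_map]
    exact h4.imp fun a b h => h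

theorem map_inj_on {V : Type} {p : ℕ → V} {j : ℕ}
    (hinj : ∀ s t, s ≤ j → t ≤ j → p s = p t → s = t) {x y : List ℕ}
    (hx : ∀ t ∈ x, t ≤ j) (hy : ∀ t ∈ y, t ≤ j) (h : x.map p = y.map p) : x = y := by
  induction x generalizing y with
  | nil => cases y with
    | nil => rfl
    | cons b y => simp at h
  | cons a x ih => cases y with
    | nil => simp at h
    | cons b y =>
      simp only [List.map_cons, List.cons.injEq] at h
      rw [ih (fun t ht => hx t (by simp [ht])) (fun t ht => hy t (by simp [ht])) h.2,
        hinj a b (hx a (by simp)) (hy b (by simp)) h.1]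

/-- the list `a, a+1, ..., b` -/
def seg (a b : ℕ) : List ℕ := List.range' a (b + 1 - a)

theorem mem_seg {a b t : ℕ} : t ∈ seg a b ↔ a ≤ t ∧ t ≤ b := by
  simp [seg]; omega

theorem length_seg {a b : ℕ} : (seg a b).length = b + 1 - a := by simp [seg]

theorem LP.seg {V : Type} {G : SimpleGraph V} {p : ℕ → V} {j : ℕ}
    (hadj : ∀ t, t < j → G.Adj (p t) (p (t + 1))) {a b : ℕ} (hab : a ≤ b) (hb : b ≤ j) :
    LP (G.comap p) a b (seg a b) := by
  obtain ⟨n, rfl⟩ := Nat.exists_eq_add_of_le hab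
  have e : _root_.seg a (a + n) = List.range' a (n + 1) := by
    simp [_root_.seg]; omega
  rw [e]; clear e hab
  induction n generalizing a with
  | zero => simpa using LP.single _ a
  | succ n ih =>
    rw [List.range'_succ]
    have := ih (a := a + 1) (by omega)
    have e : a + 1 + n = a + (n + 1) := by omega
    rw [e] at this
    refine LP.append (LP.single (G.comap p) a) this (hadj a (by omega)) ?_
    simp

/-- `(a, b)` is a chord of the cycle `p 0, ..., p j`. -/
def Chord {V : Type} (G : SimpleGraph V) (p : ℕ → V) (j a b : ℕ) : Prop :=
  a + 2 ≤ b ∧ b ≤ j ∧ ¬ (a = 0 ∧ b = j) ∧ G.Adj (p a) (p b)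

/-- no adjacent vertices are joined by five paths of length at least two -/
def NF {V : Type} (G : SimpleGraph V) : Prop :=
  ∀ x y, G.Adj x y → ¬ Five (fun l => LP G x y l ∧ 3 ≤ l.length)

/-- the vertices `p 0, ..., p j` form a cycle -/
def Cyc {V : Type} (G : SimpleGraph V) (p : ℕ → V) (j : ℕ) : Prop :=
  (∀ s t, s ≤ j → t ≤ j → p s = p t → s = t) ∧
  (∀ t, t < j → G.Adj (p t) (p (t + 1))) ∧ G.Adj (p 0) (p j)

theorem aligned {V : Type} {G : SimpleGraph V} (hNF : NF G) {p : ℕ → V} {j : ℕ}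
    (hC : Cyc G p j) {a b c d e f : ℕ} (h1 : Chord G p j a b) (h2 : Chord G p j c d)
    (h3 : Chord G p j e f) (hal : b ≤ c ∨ (a < c ∧ c < b ∧ b < d))
    (hn1 : ¬ (e = a ∧ f = b)) (hn2 : ¬ (e = c ∧ f = d)) : False := by
  obtain ⟨hinj, hadj, hcl⟩ := hC
  have hS : ∀ {a b}, a ≤ b → b ≤ j → LP (G.comap p) a b (seg a b) := fun h h' => LP.seg hadj h h'
  have hA : ∀ a b, Chord G p j a b → LP (G.comap p) 0 j (seg 0 a ++ seg b j) := by
    rintro a b ⟨k1, k2, k3, k4⟩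
    refine LP.append (hS (by omega) (by omega)) (hS (by omega) (by omega)) k4 ?_
    intro t; rw [mem_seg, mem_seg]; omega
  have hsort : ∀ a b, a < b → (seg a b).Pairwise (· < ·) := by
    intro a b _; exact List.pairwise_lt_range'
  have h1' := h1
  have h2' := h2
  have h3' := h3
  obtain ⟨u1, u2, u3, u4⟩ := h1'
  obtain ⟨v1, v2, v3, v4⟩ := h2'
  obtain ⟨w1, w2, w3, w4⟩ := h3'
  -- suffices: a fifth path
  have key : ∀ T : List ℕ, LP (G.comap p) 0 j T → (∀ t ∈ T, t ≤ j) → 3 ≤ T.length →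
      T ≠ seg 0 j → (∀ x y, Chord G p j x y → T ≠ seg 0 x ++ seg y j) → False := by
    intro T hT hTj hTl hT0 hT1
    apply hNF _ _ hcl
    have hmem : ∀ {x y t}, t ∈ seg 0 x ++ seg y j ↔ t ≤ x ∨ (y ≤ t ∧ t ≤ j) := by
      intro x y t; simp [mem_seg]
    have hne : ∀ x y x' y', Chord G p j x y → Chord G p j x' y' → ¬ (x = x' ∧ y = y') →
        seg 0 x ++ seg y j ≠ seg 0 x' ++ seg y' j := by
      rintro x y x' y' ⟨a1, a2, -, -⟩ ⟨b1, b2, -, -⟩ hh he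
      have hm : ∀ t, t ∈ seg 0 x ++ seg y j ↔ t ∈ seg 0 x' ++ seg y' j := by rw [he]; simp
      simp only [hmem] at hm
      have t1 := hm x
      have t2 := hm x'
      have t3 := hm y
      have t4 := hm y'
      have t5 := hm (x+1)
      have t6 := hm (x'+1)
      have t7 := hm (y-1)
      have t8 := hm (y'-1)
      omega
    have hne0 : ∀ x y, Chord G p j x y → seg 0 j ≠ seg 0 x ++ seg y j := by
      rintro x y ⟨a1, a2, -, -⟩ he
      have hm : x + 1 ∈ seg 0 j ↔ x + 1 ∈ seg 0 x ++ seg y j := by rw [he]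
      rw [hmem, mem_seg] at hm
      omega
    have hnodup : [seg 0 j, seg 0 a ++ seg b j, seg 0 c ++ seg d j, seg 0 e ++ seg f j, T].Nodup := by
      have q1 := hne0 _ _ h1
      have q2 := hne0 _ _ h2
      have q3 := hne0 _ _ h3
      have q4 := hne _ _ _ _ h1 h2 (by omega)
      have q5 := hne _ _ _ _ h1 h3 (by omega)
      have q6 := hne _ _ _ _ h2 h3 (by omega)
      have q7 := (hT1 _ _ h1).symm
      have q8 := (hT1 _ _ h2).symm
      have q9 := (hT1 _ _ h3).symm
      have q0 := hT0.symm
      simp only [List.nodup_cons, List.mem_cons, List.not_mem_nil, or_false, not_or,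
        not_false_eq_true, List.nodup_nil, and_true]
      exact ⟨⟨q1, q2, q3, q0⟩, ⟨q4, q5, q7⟩, ⟨q6, q8⟩, q9⟩
    refine ⟨[seg 0 j, seg 0 a ++ seg b j, seg 0 c ++ seg d j, seg 0 e ++ seg f j, T].map (List.map p),
      by simp, ?_, ?_⟩
    · refine List.Nodup.map_on ?_ hnodup
      have hall : ∀ x ∈ [seg 0 j, seg 0 a ++ seg b j, seg 0 c ++ seg d j, seg 0 e ++ seg f j, T],
          ∀ t ∈ x, t ≤ j := by
        intro x hx
        simp only [List.mem_cons, List.not_mem_nil, or_false] at hx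
        rcases hx with rfl | rfl | rfl | rfl | rfl
        · intro t; rw [mem_seg]; omega
        · intro t; rw [hmem]; omega
        · intro t; rw [hmem]; omega
        · intro t; rw [hmem]; omega
        · exact hTj
      intro x hx y hy hxy
      exact map_inj_on hinj (hall x hx) (hall y hy) hxy
    · intro l hl
      rw [List.mem_map] at hl
      obtain ⟨x, hx, rfl⟩ := hl
      simp only [List.mem_cons, List.not_mem_nil, or_false] at hx
      rw [List.length_map]
      rcases hx with rfl | rfl | rfl | rfl | rfl
      · exact ⟨LP.map' hinj (hS (by omega) le_rfl) (by intro t; rw [mem_seg]; omega),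
          by rw [length_seg]; omega⟩
      · exact ⟨LP.map' hinj (hA _ _ h1) (by intro t; rw [hmem]; omega),
          by rw [List.length_append, length_seg, length_seg]; omega⟩
      · exact ⟨LP.map' hinj (hA _ _ h2) (by intro t; rw [hmem]; omega),
          by rw [List.length_append, length_seg, length_seg]; omega⟩
      · exact ⟨LP.map' hinj (hA _ _ h3) (by intro t; rw [hmem]; omega),
          by rw [List.length_append, length_seg, length_seg]; omega⟩
      · exact ⟨LP.map' hinj hT hTj, hTl⟩
  rcases hal with hal | ⟨k1, k2, k3⟩
  · have hmem : ∀ t, t ∈ seg 0 a ++ seg b c ++ seg d j ↔ t ≤ a ∨ (b ≤ t ∧ t ≤ c) ∨ (d ≤ t ∧ t ≤ j) := by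
      intro t; simp [mem_seg]
    refine key (seg 0 a ++ seg b c ++ seg d j) ?_ ?_ ?_ ?_ ?_
    · refine LP.append (LP.append (hS (by omega) (by omega)) (hS (by omega) (by omega)) u4 ?_)
        (hS (by omega) (by omega)) v4 ?_
      · intro t; rw [mem_seg, mem_seg]; omega
      · intro t; rw [List.mem_append, mem_seg, mem_seg, mem_seg]; omega
    · intro t; rw [hmem]; omega
    · rw [List.length_append, List.length_append, length_seg, length_seg, length_seg]; omega
    · intro he
      have hm : a + 1 ∈ seg 0 a ++ seg b c ++ seg d j ↔ a + 1 ∈ seg 0 j := by rw [he]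
      rw [hmem, mem_seg] at hm
      omega
    · rintro x y ⟨a1, a2, -, -⟩ he
      have hm : ∀ t, t ∈ seg 0 a ++ seg b c ++ seg d j ↔ t ∈ seg 0 x ++ seg y j := by rw [he]; simp
      have hm' : ∀ t, t ∈ seg 0 x ++ seg y j ↔ t ≤ x ∨ (y ≤ t ∧ t ≤ j) := by
        intro t; simp [mem_seg]
      simp only [hmem, hm'] at hm
      have t1 := hm (a+1)
      have t2 := hm b
      have t3 := hm (c+1)
      omega
  · have hmem : ∀ t, t ∈ seg 0 a ++ (seg c b).reverse ++ seg d j ↔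
        t ≤ a ∨ (c ≤ t ∧ t ≤ b) ∨ (d ≤ t ∧ t ≤ j) := by
      intro t; simp [mem_seg]
    have hns : ¬ (seg 0 a ++ (seg c b).reverse ++ seg d j).Pairwise (· < ·) := by
      intro hp
      rw [List.pairwise_append, List.pairwise_append, List.pairwise_reverse] at hp
      have := hp.1.2.1
      have e : seg c b = c :: List.range' (c + 1) (b - c) := by
        rw [seg, show b + 1 - c = (b - c) + 1 by omega, List.range'_succ]
      rw [e, List.pairwise_cons] at this
      have := this.1 b (by simp; omega)
      omega
    refine key (seg 0 a ++ (seg c b).reverse ++ seg d j) ?_ ?_ ?_ ?_ ?_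
    · refine LP.append (LP.append (hS (by omega) (by omega)) (hS (by omega) (by omega)).rev u4 ?_)
        (hS (by omega) (by omega)) v4 ?_
      · intro t; rw [List.mem_reverse, mem_seg, mem_seg]; omega
      · intro t; rw [List.mem_append, List.mem_reverse, mem_seg, mem_seg, mem_seg]; omega
    · intro t; rw [hmem]; omega
    · rw [List.length_append, List.length_append, List.length_reverse, length_seg, length_seg,
        length_seg]; omega
    · intro he
      apply hns; rw [he]; exact List.pairwise_lt_range'
    · rintro x y ⟨a1, a2, -, -⟩ he
      apply hns; rw [he, List.pairwise_append]
      refine ⟨List.pairwise_lt_range', List.pairwise_lt_range', ?_⟩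
      intro s hs t ht
      rw [mem_seg] at hs ht; omega

/-- the rotated index -/
def ri (j r t : ℕ) : ℕ := if t + r ≤ j then t + r else t + r - (j + 1)

theorem Cyc.rot {V : Type} {G : SimpleGraph V} {p : ℕ → V} {j : ℕ} (hC : Cyc G p j) {r : ℕ}
    (hr : r ≤ j) : Cyc G (fun t => p (ri j r t)) j := by
  obtain ⟨h1, h2, h3⟩ := hC
  have hA : ∀ s t, (t = s + 1 ∧ t ≤ j) ∨ (s = j ∧ t = 0) → G.Adj (p s) (p t) := by
    rintro s t (⟨rfl, h⟩ | ⟨rfl, rfl⟩)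
    · exact h2 s h
    · exact h3.symm
  refine ⟨?_, ?_, ?_⟩
  · intro s t hs ht h
    have := h1 _ _ (by unfold ri; split_ifs <;> omega) (by unfold ri; split_ifs <;> omega) h
    unfold ri at this
    split_ifs at this <;> omega
  · intro t ht
    apply hA
    unfold ri; split_ifs <;> omega
  · apply SimpleGraph.Adj.symm
    apply hA
    unfold ri; split_ifs <;> omega

/-- first end of a rotated chord -/
def cE (j r e f : ℕ) : ℕ := if r ≤ e then e - r else if r ≤ f then f - r else e + (j + 1) - r
/-- second end of a rotated chord -/
def cF (j r e f : ℕ) : ℕ :=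
  if r ≤ e then f - r else if r ≤ f then e + (j + 1) - r else f + (j + 1) - r

theorem Chord.rot {V : Type} {G : SimpleGraph V} {p : ℕ → V} {j r e f : ℕ}
    (h : Chord G p j e f) (hr : r ≤ j) :
    Chord G (fun t => p (ri j r t)) j (cE j r e f) (cF j r e f) := by
  obtain ⟨h1, h2, h3, h4⟩ := h
  refine ⟨by unfold cE cF; split_ifs <;> omega, by unfold cF; split_ifs <;> omega,
    by unfold cE cF; split_ifs <;> omega, ?_⟩
  have hh : (ri j r (cE j r e f) = e ∧ ri j r (cF j r e f) = f) ∨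
      (ri j r (cE j r e f) = f ∧ ri j r (cF j r e f) = e) := by
    unfold ri cE cF; split_ifs <;> omega
  rcases hh with ⟨ha, hb⟩ | ⟨ha, hb⟩
  · simpa only [ha, hb] using h4
  · simpa only [ha, hb] using h4.symm

theorem nested {V : Type} {G : SimpleGraph V} (hNF : NF G) {p : ℕ → V} {j : ℕ}
    (hC : Cyc G p j) {a b c d e f : ℕ} (h1 : Chord G p j a b) (h2 : Chord G p j c d)
    (h3 : Chord G p j e f) (hal : a ≤ c ∧ d ≤ b)
    (hn : ¬ (a = c ∧ b = d)) (hn1 : ¬ (e = a ∧ f = b)) (hn2 : ¬ (e = c ∧ f = d)) : False := by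
  have h1' := h1
  have h2' := h2
  have h3' := h3
  obtain ⟨u1, u2, u3, -⟩ := h1'
  obtain ⟨v1, v2, v3, -⟩ := h2'
  obtain ⟨w1, w2, w3, -⟩ := h3'
  by_cases hdb : d < b
  · refine aligned hNF (hC.rot u2) (h1.rot u2) (h2.rot u2) (h3.rot u2) (Or.inl ?_) ?_ ?_
    · unfold cE cF; split_ifs <;> omega
    · unfold cE cF; split_ifs <;> omega
    · unfold cE cF; split_ifs <;> omega
  · have hr : a + 1 ≤ j := by omega
    refine aligned hNF (hC.rot hr) (h2.rot hr) (h1.rot hr) (h3.rot hr) (Or.inl ?_) ?_ ?_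
    · unfold cE cF; split_ifs <;> omega
    · unfold cE cF; split_ifs <;> omega
    · unfold cE cF; split_ifs <;> omega

/-- A cycle has at most two chords. -/
theorem threeChords {V : Type} {G : SimpleGraph V} (hNF : NF G) {p : ℕ → V} {j : ℕ}
    (hC : Cyc G p j) {a b c d e f : ℕ} (h1 : Chord G p j a b) (h2 : Chord G p j c d)
    (h3 : Chord G p j e f)
    (hn : ¬ (a = c ∧ b = d)) (hn1 : ¬ (e = a ∧ f = b)) (hn2 : ¬ (e = c ∧ f = d)) : False := by
  wlog hac : a < c ∨ (a = c ∧ d < b) generalizing a b c d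
  · exact this h2 h1 (by omega) hn2 hn1 (by omega)
  by_cases hdb : d ≤ b
  · exact nested hNF hC h1 h2 h3 (by omega) hn hn1 hn2
  · exact aligned hNF hC h1 h2 h3 (by omega) hn1 hn2


/-- `p 0, ..., p k` is a path inside `s` -/
def PathIn {V : Type} (G : SimpleGraph V) (s : Finset V) (p : ℕ → V) (k : ℕ) : Prop :=
  (∀ a b, a ≤ k → b ≤ k → p a = p b → a = b) ∧
  (∀ t, t < k → G.Adj (p t) (p (t + 1))) ∧ ∀ t, t ≤ k → p t ∈ s

/-- path rotation -/
def rt {V : Type} (i : ℕ) (p : ℕ → V) (t : ℕ) : V := if t < i then p (i - 1 - t) else p t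

theorem rt_lt {V : Type} {i : ℕ} {p : ℕ → V} {t : ℕ} (h : t < i) : rt i p t = p (i - 1 - t) := by
  simp [rt, h]

theorem rt_ge {V : Type} {i : ℕ} {p : ℕ → V} {t : ℕ} (h : i ≤ t) : rt i p t = p t := by
  simp [rt, Nat.not_lt.2 h]

theorem PathIn.rt {V : Type} {G : SimpleGraph V} {s : Finset V} {p : ℕ → V} {k i : ℕ}
    (h : PathIn G s p k) (hi : i ≤ k) (ha : G.Adj (p 0) (p i)) :
    PathIn G s (rt i p) k := by
  obtain ⟨hinj, hadj, hs⟩ := h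
  refine ⟨?_, ?_, ?_⟩
  · intro a b hak hbk hab
    unfold _root_.rt at hab
    split_ifs at hab
    · have := hinj _ _ (by omega) (by omega) hab; omega
    · have := hinj _ _ (by omega) (by omega) hab; omega
    · have := hinj _ _ (by omega) (by omega) hab; omega
    · have := hinj _ _ (by omega) (by omega) hab; omega
  · intro t ht
    rcases lt_trichotomy (t + 1) i with h | h | h
    · rw [rt_lt (by omega), rt_lt h]
      have := hadj (i - 1 - (t + 1)) (by omega)
      rw [show i - 1 - (t + 1) + 1 = i - 1 - t by omega] at this
      exact this.symm
    · rw [rt_lt (by omega), rt_ge (by omega), show i - 1 - t = 0 by omega, h]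
      exact ha
    · rw [rt_ge (by omega), rt_ge (by omega)]
      exact hadj t ht
  · intro t ht
    unfold _root_.rt
    split_ifs
    · exact hs _ (by omega)
    · exact hs _ ht

theorem exists_greatest {P : ℕ → Prop} (hne : ∃ n, P n) (B : ℕ) (hB : ∀ n, P n → n ≤ B) :
    ∃ n, P n ∧ ∀ m, P m → m ≤ n := by
  classical
  obtain ⟨n, hn⟩ := hne
  exact ⟨Nat.findGreatest P B, Nat.findGreatest_spec (hB n hn) hn,
    fun m hm => Nat.le_findGreatest (hB m hm) hm⟩

theorem PathIn.card {V : Type} {G : SimpleGraph V} {s : Finset V} {p : ℕ → V} {k : ℕ}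
    (h : PathIn G s p k) : k ≤ s.card := by
  classical
  have : (Finset.range (k + 1)).card ≤ s.card := by
    apply Finset.card_le_card_of_injOn p
    · intro t ht
      exact h.2.2 t (by simp at ht; omega)
    · intro a ha b hb hab
      exact h.1 a b (by simp at ha; omega) (by simp at hb; omega) hab
  simp at this; omega

theorem PathIn.extend {V : Type} {G : SimpleGraph V} {s : Finset V} {p : ℕ → V} {k : ℕ}
    (h : PathIn G s p k) {v : V} (hv : v ∈ s) (ha : G.Adj (p 0) v) (hn : ∀ t, t ≤ k → p t ≠ v) :
    PathIn G s (fun t => if t = 0 then v else p (t - 1)) (k + 1) := by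
  obtain ⟨hinj, hadj, hs⟩ := h
  refine ⟨?_, ?_, ?_⟩
  · intro a b hak hbk hab
    dsimp only at hab
    split_ifs at hab
    · omega
    · exact absurd hab.symm (hn _ (by omega))
    · exact absurd hab (hn _ (by omega))
    · have := hinj _ _ (by omega) (by omega) hab; omega
  · intro t ht
    dsimp only
    rw [if_neg (show ¬ t + 1 = 0 by omega)]
    split_ifs with h0
    · subst h0; exact ha.symm
    · have := hadj (t - 1) (by omega)
      rw [show t - 1 + 1 = t + 1 - 1 by omega] at this
      exact this
  · intro t ht
    dsimp only
    split_ifs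
    · exact hv
    · exact hs _ (by omega)

theorem structure_lemma {V : Type} {G : SimpleGraph V} [DecidableEq V] [DecidableRel G.Adj]
    (hNF : NF G) (s : Finset V) (hs : s.Nonempty)
    (hdeg : ∀ v ∈ s, 3 ≤ (s.filter (G.Adj v)).card) :
    ∃ (p : ℕ → V) (j : ℕ), Cyc G p j ∧ (∀ t, t ≤ j → p t ∈ s) ∧
     ((j = 3 ∧ G.Adj (p 0) (p 2) ∧ G.Adj (p 1) (p 3) ∧
        ∀ a, a < 3 → ∀ v ∈ s, G.Adj (p a) v → ∃ t, t ≤ 3 ∧ t ≠ a ∧ v = p t) ∨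
      (j = 4 ∧ ∀ a, a < 4 → ∀ v ∈ s, G.Adj (p a) v → ∃ t, t ≤ 4 ∧ t ≠ a ∧ v = p t ∧
        ¬ (a = 0 ∧ t = 3) ∧ ¬ (a = 3 ∧ t = 0) ∧ (t = 4 → a = 0 ∨ a = 3))) := by
  classical
  -- longest path
  obtain ⟨k, ⟨p0, hp0⟩, hk⟩ := exists_greatest (P := fun k => ∃ p, PathIn G s p k)
    (by
      obtain ⟨v, hv⟩ := hs
      exact ⟨0, fun _ => v, fun a b ha hb _ => by omega, fun t ht => by omega, fun t _ => hv⟩)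
    s.card (fun n ⟨p, hp⟩ => hp.card)
  have hnb : ∀ q, PathIn G s q k → ∀ v ∈ s, G.Adj (q 0) v → ∃ m, 1 ≤ m ∧ m ≤ k ∧ q m = v := by
    intro q hq v hv ha
    by_contra hcon
    have hn : ∀ t, t ≤ k → q t ≠ v := by
      intro t ht he
      by_cases h0 : t = 0
      · subst h0; rw [he] at ha; exact G.loopless.irrefl _ ha
      · exact hcon ⟨t, by omega, ht, he⟩
    have := hk _ ⟨_, hq.extend hv ha hn⟩
    omega
  -- maximal back edge
  obtain ⟨j, ⟨p, hp, hj1, hjk, hpj⟩, hj⟩ := exists_greatest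
    (P := fun j => ∃ p, PathIn G s p k ∧ 1 ≤ j ∧ j ≤ k ∧ G.Adj (p 0) (p j))
    (by
      have h3 := hdeg (p0 0) (hp0.2.2 0 (by omega))
      have : (s.filter (G.Adj (p0 0))).Nonempty := by
        rw [← Finset.card_pos]; omega
      obtain ⟨v, hv⟩ := this
      rw [Finset.mem_filter] at hv
      obtain ⟨m, hm1, hm2, hm3⟩ := hnb p0 hp0 v hv.1 hv.2
      exact ⟨m, p0, hp0, hm1, hm2, by rw [hm3]; exact hv.2⟩)
    k (fun n ⟨p, hp⟩ => hp.2.2.1)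
  have hC : Cyc G p j := ⟨fun a b ha hb => hp.1 a b (by omega) (by omega),
    fun t ht => hp.2.1 t (by omega), hpj⟩
  let Q : (ℕ → V) → Prop := fun q => PathIn G s q k ∧ (∀ t, j ≤ t → t ≤ k → q t = p t) ∧
    ∀ t, t ≤ j → ∃ u, u ≤ j ∧ q t = p u
  have hQp : Q p := ⟨hp, fun _ _ _ => rfl, fun t ht => ⟨t, ht, rfl⟩⟩
  have hQr : ∀ q i, Q q → 1 ≤ i → i ≤ j → G.Adj (q 0) (q i) → Q (rt i q) := by
    rintro q i ⟨hq1, hq2, hq3⟩ hi1 hij ha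
    refine ⟨hq1.rt (by omega) ha, ?_, ?_⟩
    · intro t h1 h2
      rw [rt_ge (by omega)]; exact hq2 t h1 h2
    · intro t ht
      unfold rt
      split_ifs
      · exact hq3 _ (by omega)
      · exact hq3 _ ht
  have hQn : ∀ q a, Q q → q 0 = p a → ∀ v ∈ s, G.Adj (p a) v → ∃ t, t ≤ j ∧ v = p t := by
    rintro q a ⟨hq1, hq2, hq3⟩ ha v hv hav
    rw [← ha] at hav
    obtain ⟨m, hm1, hm2, rfl⟩ := hnb q hq1 v hv hav
    exact hq3 m (hj m ⟨q, hq1, hm1, hm2, hav⟩)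
  have hQc : ∀ q a, Q q → a < j → q 0 = p a → ∃ d, Chord G p j a d ∨ Chord G p j d a := by
    intro q a hq haj ha
    have h3 := hdeg (p a) (hp.2.2 a (by omega))
    have : ∃ v ∈ s.filter (G.Adj (p a)), v ∉ ({p (a + 1), p (if a = 0 then j else a - 1)} : Finset V) := by
      by_contra hcon
      push Not at hcon
      have := Finset.card_le_card (show s.filter (G.Adj (p a)) ⊆ _ from hcon)
      have := this.trans Finset.card_le_two
      omega
    obtain ⟨v, hv, hv2⟩ := this
    rw [Finset.mem_filter] at hv
    obtain ⟨t, ht, rfl⟩ := hQn q a hq ha v hv.1 hv.2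
    simp only [Finset.mem_insert, Finset.mem_singleton, not_or] at hv2
    have t1 : t ≠ a + 1 := fun h => hv2.1 (by rw [h])
    have t2 : t ≠ if a = 0 then j else a - 1 := fun h => hv2.2 (by rw [← h])
    have t3 : t ≠ a := fun h => hv.2.ne (by rw [h])
    refine ⟨t, ?_⟩
    by_cases hat : a < t
    · left
      refine ⟨by omega, ht, ?_, hv.2⟩
      rintro ⟨rfl, rfl⟩; simp at t2
    · right
      refine ⟨?_, by omega, by omega, hv.2.symm⟩
      split_ifs at t2 <;> omega
  -- chord at 0
  obtain ⟨i, hi⟩ : ∃ i, Chord G p j 0 i := by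
    obtain ⟨d, h | h⟩ := hQc p 0 hQp (by omega) rfl
    · exact ⟨d, h⟩
    · exact absurd h.1 (by omega)
  have hi' := hi
  obtain ⟨i1, i2, i3, i4⟩ := hi'
  -- reversed path
  have hQ1 : Q (rt j p) := hQr p j hQp hj1 le_rfl hpj
  have e1 : rt j p 0 = p (j - 1) := by rw [rt_lt (by omega)]; congr 1
  obtain ⟨d, hd⟩ : ∃ d, Chord G p j d (j - 1) := by
    obtain ⟨d, h | h⟩ := hQc _ (j - 1) hQ1 (by omega) e1
    · obtain ⟨k1, k2, -⟩ := h; omega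
    · exact ⟨d, h⟩
  have hd' := hd
  obtain ⟨d1, d2, d3, d4⟩ := hd'
  have hQ2 : Q (rt i p) := hQr p i hQp (by omega) i2 i4
  have e2 : rt i p 0 = p (i - 1) := by rw [rt_lt (by omega)]; congr 1
  obtain ⟨x, hx⟩ := hQc _ (i - 1) hQ2 (by omega) e2
  refine ⟨p, j, hC, fun t ht => hp.2.2 t (by omega), ?_⟩
  have h3c := fun {a b c d e f : ℕ} => threeChords hNF hC (a := a) (b := b) (c := c) (d := d) (e := e) (f := f)
  by_cases hA : i = j - 1 ∧ d = 0
  · left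
    obtain ⟨rfl, rfl⟩ := hA
    have e3 : rt j p (j - 1) = p 0 := by rw [rt_lt (by omega)]; congr 1; omega
    have hQ3 : Q (rt (j - 1) (rt j p)) := by
      apply hQr _ _ hQ1 (by omega) (by omega)
      rw [e1, e3]; exact i4.symm
    have e4 : rt (j - 1) (rt j p) 0 = p 1 := by
      rw [rt_lt (by omega), rt_lt (by omega)]; congr 1; omega
    obtain ⟨y, hy⟩ := hQc _ 1 hQ3 (by omega) e4
    have hj3 : j = 3 := by
      by_contra hne
      -- the second chord is (1, j-2)
      have hch : Chord G p j 1 (j - 2) := by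
        have hy' : Chord G p j 1 y := by
          rcases hy with h | h
          · exact h
          · exact absurd h.1 (by omega)
        by_cases hyj : y = j - 2
        · rw [← hyj]; exact hy'
        · exfalso
          rcases hx with h | h
          · exact h3c hi hy' h (by omega) (by omega) (by omega)
          · exact h3c hi hy' h (by omega) (by have := h.1; omega) (by omega)
      have hch' := hch
      obtain ⟨c1, c2, c3, c4⟩ := hch'
      have e5 : rt (j - 1) (rt j p) (j - 3) = p (j - 2) := by
        rw [rt_lt (by omega), rt_lt (by omega)]; congr 1; omega
      have hQ4 : Q (rt (j - 3) (rt (j - 1) (rt j p))) := by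
        apply hQr _ _ hQ3 (by omega) (by omega)
        rw [e4, e5]; exact c4
      have e6 : rt (j - 3) (rt (j - 1) (rt j p)) 0 = p (j - 3) := by
        rw [rt_lt (by omega), rt_lt (by omega), rt_lt (by omega)]; congr 1; omega
      obtain ⟨z, hz | hz⟩ := hQc _ (j - 3) hQ4 (by omega) e6
      · exact h3c hi hch hz (by omega) (by omega) (by omega)
      · exact h3c hi hch hz (by omega) (by omega) (by omega)
    subst hj3
    have h13 : Chord G p 3 1 3 := by
      rcases hy with h | h
      · have h' := h
        obtain ⟨c1, c2, -⟩ := h'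
        have : y = 3 := by omega
        rw [← this]; rw [this] at h ⊢; exact h
      · exact absurd h.1 (by omega)
    refine ⟨rfl, i4, h13.2.2.2, ?_⟩
    have hall : ∀ a, a < 3 → ∃ q, Q q ∧ q 0 = p a := by
      intro a ha
      interval_cases a
      · exact ⟨_, hQp, rfl⟩
      · exact ⟨_, hQ3, e4⟩
      · exact ⟨_, hQ1, e1⟩
    intro a ha v hv hav
    obtain ⟨q, hq, hq0⟩ := hall a ha
    obtain ⟨t, ht, rfl⟩ := hQn q a hq hq0 v hv hav
    exact ⟨t, ht, fun h => hav.ne (by rw [h]), rfl⟩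
  · right
    have hcov : ∀ e f, Chord G p j e f → (e = 0 ∧ f = i) ∨ (e = d ∧ f = j - 1) := by
      intro e f h
      by_contra hcon
      exact h3c hi hd h (by omega) (by omega) (by omega)
    have hdi : d = i - 1 := by
      rcases hx with h | h
      · rcases hcov _ _ h with h | h <;> omega
      · rcases hcov _ _ h with h | h <;> omega
    subst hdi
    -- j - 2 = i
    have hQ3 : Q (rt (j - 1) (rt i p)) := by
      apply hQr _ _ hQ2 (by omega) (by omega)
      rw [e2, rt_ge (by omega)]; exact d4
    have e3 : rt (j - 1) (rt i p) 0 = p (j - 2) := by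
      rw [rt_lt (by omega), rt_ge (by omega)]; congr 1
    have hji : j - 2 = i := by
      obtain ⟨z, hz | hz⟩ := hQc _ (j - 2) hQ3 (by omega) e3
      · rcases hcov _ _ hz with h | h <;> omega
      · rcases hcov _ _ hz with h | h <;> omega
    -- other side
    have hQ4 : Q (rt (j - i) (rt j p)) := by
      apply hQr _ _ hQ1 (by omega) (by omega)
      rw [e1, rt_lt (by omega), show j - 1 - (j - i) = i - 1 by omega]; exact d4.symm
    have e4 : rt (j - i) (rt j p) 0 = p i := by
      rw [rt_lt (by omega), rt_lt (by omega)]; congr 1; omega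
    have hQ5 : Q (rt (j - 1) (rt (j - i) (rt j p))) := by
      apply hQr _ _ hQ4 (by omega) (by omega)
      rw [e4, rt_ge (by omega), rt_lt (by omega), show j - 1 - (j - 1) = 0 by omega]; exact i4.symm
    have e5 : rt (j - 1) (rt (j - i) (rt j p)) 0 = p 1 := by
      rw [rt_lt (by omega), rt_ge (by omega), rt_lt (by omega)]; congr 1; omega
    have hi2 : i = 2 := by
      obtain ⟨z, hz | hz⟩ := hQc _ 1 hQ5 (by omega) e5
      · rcases hcov _ _ hz with h | h <;> omega
      · rcases hcov _ _ hz with h | h <;> omega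
    have hj4 : j = 4 := by omega
    subst hi2 hj4
    refine ⟨rfl, ?_⟩
    have hall : ∀ a, a < 4 → ∃ q, Q q ∧ q 0 = p a := by
      intro a ha
      interval_cases a
      · exact ⟨_, hQp, rfl⟩
      · exact ⟨_, hQ2, e2⟩
      · exact ⟨_, hQ3, e3⟩
      · exact ⟨_, hQ1, e1⟩
    intro a ha v hv hav
    obtain ⟨q, hq, hq0⟩ := hall a ha
    obtain ⟨t, ht, rfl⟩ := hQn q a hq hq0 v hv hav
    refine ⟨t, ht, fun h => hav.ne (by rw [h]), rfl, ?_, ?_, ?_⟩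
    · rintro ⟨rfl, rfl⟩
      have := hcov 0 3 ⟨by omega, by omega, by omega, hav⟩
      omega
    · rintro ⟨rfl, rfl⟩
      have := hcov 0 3 ⟨by omega, by omega, by omega, hav.symm⟩
      omega
    · rintro rfl
      by_contra hcon
      have := hcov a 4 ⟨by omega, by omega, by omega, hav⟩
      omega


/-- twice the number of edges inside `s` -/
def eN {V : Type} (G : SimpleGraph V) [DecidableRel G.Adj] (s : Finset V) : ℕ :=
  ∑ v ∈ s, (s.filter (G.Adj v)).card

theorem eN_erase {V : Type} [DecidableEq V] (G : SimpleGraph V) [DecidableRel G.Adj]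
    {s : Finset V} {v : V} (hv : v ∈ s) :
    eN G s = eN G (s.erase v) + 2 * (s.filter (G.Adj v)).card := by
  unfold eN
  rw [← Finset.add_sum_erase s _ hv]
  have h1 : ∀ w ∈ s.erase v, (s.filter (G.Adj w)).card =
      ((s.erase v).filter (G.Adj w)).card + if G.Adj v w then 1 else 0 := by
    intro w hw
    rw [← Finset.insert_erase hv, Finset.filter_insert]
    simp only [Finset.erase_insert_eq_erase, Finset.erase_idem]
    split_ifs with ha hb hb
    · rw [Finset.card_insert_of_notMem]; simp
    · exact absurd ha.symm hb
    · exact absurd hb.symm ha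
    · rfl
  rw [Finset.sum_congr rfl h1, Finset.sum_add_distrib, ← Finset.card_filter]
  have h2 : (s.erase v).filter (G.Adj v) = s.filter (G.Adj v) := by
    ext w
    simp only [Finset.mem_filter, Finset.mem_erase]
    constructor
    · rintro ⟨⟨-, h⟩, h'⟩; exact ⟨h, h'⟩
    · rintro ⟨h, h'⟩; exact ⟨⟨h'.ne', h⟩, h'⟩
  rw [h2]; ring

theorem eN_erase_le {V : Type} [DecidableEq V] (G : SimpleGraph V) [DecidableRel G.Adj]
    {s : Finset V} {v : V} (hv : v ∈ s) (N : Finset V) (hN : ∀ w ∈ s, G.Adj v w → w ∈ N) :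
    eN G s ≤ eN G (s.erase v) + 2 * N.card := by
  rw [eN_erase G hv]
  have : (s.filter (G.Adj v)).card ≤ N.card := by
    apply Finset.card_le_card
    intro w hw
    rw [Finset.mem_filter] at hw
    exact hN w hw.1 hw.2
  omega

theorem LP.mem_left {V : Type} {G : SimpleGraph V} {x y : V} {l : List V} (h : LP G x y l) : x ∈ l :=
  List.mem_of_mem_head? h.1

theorem LP.mem_right {V : Type} {G : SimpleGraph V} {x y : V} {l : List V} (h : LP G x y l) : y ∈ l :=
  List.mem_of_getLast? h.2.1

theorem LP.two_le {V : Type} {G : SimpleGraph V} {x y : V} {l : List V} (h : LP G x y l)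
    (hxy : x ≠ y) : 2 ≤ l.length := by
  have h1 := h.mem_left
  have h2 := h.mem_right
  match l with
  | [] => simp at h1
  | [a] => simp at h1 h2; exact absurd (h1.trans h2.symm) hxy
  | a :: b :: l => simp

theorem five_rev {V : Type} {G : SimpleGraph V} {s : Finset V} {x y : V}
    (h : Five (fun l => LP G x y l ∧ ∀ t ∈ l, t ∈ s)) : Five (fun l => LP G y x l ∧ ∀ t ∈ l, t ∈ s) := by
  obtain ⟨L, h1, h2, h3⟩ := h
  refine ⟨L.map List.reverse, by simpa using h1, h2.map List.reverse_injective, ?_⟩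
  intro l hl
  rw [List.mem_map] at hl
  obtain ⟨m, hm, rfl⟩ := hl
  exact ⟨(h3 m hm).1.rev, fun t ht => (h3 m hm).2 t (by simpa using ht)⟩

theorem five_app {V : Type} {G : SimpleGraph V} {s s' : Finset V} {x y z : V}
    (h : Five (fun l => LP G x y l ∧ ∀ t ∈ l, t ∈ s)) (hyz : G.Adj y z) (hz : z ∉ s)
    (hzs : z ∈ s') (hss : s ⊆ s') (hxy : x ≠ y) :
    Five (fun l => LP G x z l ∧ (∀ t ∈ l, t ∈ s') ∧ 3 ≤ l.length) := by
  obtain ⟨L, h1, h2, h3⟩ := h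
  refine ⟨L.map (· ++ [z]), by simpa using h1, h2.map (List.append_left_injective [z]), ?_⟩
  intro l hl
  rw [List.mem_map] at hl
  obtain ⟨m, hm, rfl⟩ := hl
  have hm3 := h3 m hm
  refine ⟨LP.append hm3.1 (LP.single G z) hyz ?_, ?_, ?_⟩
  · intro t ht hh
    simp at hh
    subst hh
    exact hz (hm3.2 _ ht)
  · intro t ht
    rw [List.mem_append] at ht
    rcases ht with ht | ht
    · exact hss (hm3.2 _ ht)
    · simp at ht; subst ht; exact hzs
  · have := hm3.1.two_le hxy
    simp; omega

theorem Five.imp {V : Type} {P Q : List V → Prop} (h : Five P) (hh : ∀ l, P l → Q l) : Five Q := by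
  obtain ⟨L, h1, h2, h3⟩ := h
  exact ⟨L, h1, h2, fun l hl => hh l (h3 l hl)⟩

theorem five_K4 {V : Type} {G : SimpleGraph V} {s : Finset V} {a b c d : V}
    (ha : a ∈ s) (hb : b ∈ s) (hc : c ∈ s) (hd : d ∈ s)
    (hab : G.Adj a b) (hac : G.Adj a c) (had : G.Adj a d) (hbc : G.Adj b c) (hbd : G.Adj b d)
    (hcd : G.Adj c d) : Five (fun l => LP G a b l ∧ ∀ t ∈ l, t ∈ s) := by
  have h1 := hab.ne
  have h2 := hac.ne
  have h3 := had.ne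
  have h4 := hbc.ne
  have h5 := hbd.ne
  have h6 := hcd.ne
  refine ⟨[[a, b], [a, c, b], [a, d, b], [a, c, d, b], [a, d, c, b]], rfl, ?_, ?_⟩
  · simp [h6, h6.symm, h4.symm, h5.symm]
  · simp [LP, *, hbc.symm, hbd.symm, hcd.symm, h6.symm, h4.symm, h5.symm]

theorem main_bound {V : Type} [DecidableEq V] {G : SimpleGraph V} [DecidableRel G.Adj]
    (hNF : NF G) (n : ℕ) : ∀ s : Finset V, s.card = n → s.Nonempty →
      eN G s + 4 ≤ 4 * s.card ∧ (eN G s + 4 = 4 * s.card → s.card % 3 = 1 ∧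
        ∀ x ∈ s, ∀ y ∈ s, x ≠ y → Five (fun l => LP G x y l ∧ ∀ t ∈ l, t ∈ s)) := by
  induction n using Nat.strong_induction_on with
  | _ n ih =>
  intro s hsn hs
  by_cases hlow : ∃ v ∈ s, (s.filter (G.Adj v)).card ≤ 2
  · obtain ⟨v, hv, hd⟩ := hlow
    have he := eN_erase G hv
    have hcard := Finset.card_erase_of_mem hv
    have hpos := hs.card_pos
    rcases (s.erase v).eq_empty_or_nonempty with h0 | h0
    · have hs1 : s = {v} := by
        rw [← Finset.insert_erase hv, h0]; rfl
      subst hs1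
      have : eN G {v} = 0 := by simp [eN, Finset.filter_singleton]
      rw [this]
      refine ⟨by simp, fun _ => ⟨by simp, ?_⟩⟩
      intro x hx y hy hxy
      rw [Finset.mem_singleton] at hx hy
      exact absurd (hx.trans hy.symm) hxy
    · have ih' := ih (s.erase v).card (by omega) (s.erase v) rfl h0
      have hpos' := h0.card_pos
      refine ⟨by omega, fun ht => ?_⟩
      exfalso
      have hd2 : (s.filter (G.Adj v)).card = 2 := by omega
      obtain ⟨-, h5⟩ := ih'.2 (by omega)
      obtain ⟨x, y, hxy, hf⟩ := Finset.card_eq_two.1 hd2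
      have hx : x ∈ s.filter (G.Adj v) := by rw [hf]; simp
      have hy : y ∈ s.filter (G.Adj v) := by rw [hf]; simp
      rw [Finset.mem_filter] at hx hy
      have := h5 x (Finset.mem_erase.2 ⟨hx.2.ne', hx.1⟩) y (Finset.mem_erase.2 ⟨hy.2.ne', hy.1⟩) hxy
      refine hNF x v hx.2.symm ((five_app (s' := s) this hy.2.symm (by simp) hv
        (Finset.erase_subset _ _) hxy).imp ?_)
      exact fun l hl => ⟨hl.1, hl.2.2⟩
  · push Not at hlow
    obtain ⟨p, j, ⟨hinj, hadj, hcl⟩, hps, h | h⟩ := structure_lemma hNF s hs (fun v hv => hlow v hv)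
    · obtain ⟨rfl, h02, h13, hN⟩ := h
      have h01 := hadj 0 (by omega)
      have h12 := hadj 1 (by omega)
      have h23 := hadj 2 (by omega)
      have m0 := hps 0 (by omega)
      have m1 := hps 1 (by omega)
      have m2 := hps 2 (by omega)
      have m3 := hps 3 (by omega)
      simp only [zero_add, Nat.reduceAdd] at h01 h12 h23
      have m1' : p 1 ∈ s.erase (p 0) := Finset.mem_erase.2 ⟨h01.ne', m1⟩
      have m2' : p 2 ∈ (s.erase (p 0)).erase (p 1) :=
        Finset.mem_erase.2 ⟨h12.ne', Finset.mem_erase.2 ⟨h02.ne', m2⟩⟩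
      have m3' : p 3 ∈ ((s.erase (p 0)).erase (p 1)).erase (p 2) :=
        Finset.mem_erase.2 ⟨h23.ne', Finset.mem_erase.2 ⟨h13.ne', Finset.mem_erase.2 ⟨hcl.ne', m3⟩⟩⟩
      have c0 := Finset.card_erase_of_mem m0
      have c1 := Finset.card_erase_of_mem m1'
      have c2 := Finset.card_erase_of_mem m2'
      have b0 := eN_erase_le G m0 {p 1, p 2, p 3} (by
        intro w hw ha
        obtain ⟨t, ht, hta, rfl⟩ := hN 0 (by omega) w hw ha
        interval_cases t <;> simp at hta ⊢)
      have b1 := eN_erase_le G m1' {p 2, p 3} (by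
        intro w hw ha
        obtain ⟨t, ht, hta, rfl⟩ := hN 1 (by omega) w (Finset.mem_of_mem_erase hw) ha
        interval_cases t <;> simp at hta hw ⊢)
      have b2 := eN_erase_le G m2' {p 3} (by
        intro w hw ha
        obtain ⟨t, ht, hta, rfl⟩ := hN 2 (by omega) w
          (Finset.mem_of_mem_erase (Finset.mem_of_mem_erase hw)) ha
        interval_cases t <;> simp at hta hw ⊢)
      have k0 : ({p 1, p 2, p 3} : Finset V).card ≤ 3 := Finset.card_le_three
      have k1 : ({p 2, p 3} : Finset V).card ≤ 2 := Finset.card_le_two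
      have k2 : ({p 3} : Finset V).card = 1 := Finset.card_singleton _
      have hne : (((s.erase (p 0)).erase (p 1)).erase (p 2)).Nonempty := ⟨_, m3'⟩
      have hp3 := hne.card_pos
      have hcs : s.card = (((s.erase (p 0)).erase (p 1)).erase (p 2)).card + 3 := by omega
      have hsub : ((s.erase (p 0)).erase (p 1)).erase (p 2) ⊆ s :=
        (Finset.erase_subset _ _).trans ((Finset.erase_subset _ _).trans (Finset.erase_subset _ _))
      have hmem : ∀ x ∈ s, x = p 0 ∨ x = p 1 ∨ x = p 2 ∨
          x ∈ ((s.erase (p 0)).erase (p 1)).erase (p 2) := by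
        intro x hx; simp only [Finset.mem_erase]; tauto
      have n0 : p 0 ∉ ((s.erase (p 0)).erase (p 1)).erase (p 2) := by simp
      have n1 : p 1 ∉ ((s.erase (p 0)).erase (p 1)).erase (p 2) := by simp
      have n2 : p 2 ∉ ((s.erase (p 0)).erase (p 1)).erase (p 2) := by simp
      have ih' := ih _ (by omega) (((s.erase (p 0)).erase (p 1)).erase (p 2)) rfl hne
      refine ⟨by omega, fun ht => ?_⟩
      obtain ⟨hmod, h5⟩ := ih'.2 (by omega)
      refine ⟨by omega, ?_⟩
      generalize ((s.erase (p 0)).erase (p 1)).erase (p 2) = s' at *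
      -- a path system from a vertex of the old part to a new vertex
      have hold : ∀ x ∈ s', ∀ z ∈ s, z ∉ s' → G.Adj (p 3) z →
          Five (fun l => LP G (p 3) z l ∧ ∀ t ∈ l, t ∈ s) →
          Five (fun l => LP G x z l ∧ ∀ t ∈ l, t ∈ s) := by
        intro x hx z hz hz' ha hF
        by_cases hx3 : x = p 3
        · rw [hx3]; exact hF
        · exact (five_app (s' := s) (h5 x hx (p 3) m3' hx3) ha hz' hz hsub hx3).imp
            fun l hl => ⟨hl.1, hl.2.1⟩
      have o0 : ∀ x ∈ s', Five (fun l => LP G x (p 0) l ∧ ∀ t ∈ l, t ∈ s) := fun x hx =>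
        hold x hx (p 0) m0 n0 hcl.symm
          (five_K4 m3 m0 m1 m2 hcl.symm h13.symm h23.symm h01 h02 h12)
      have o1 : ∀ x ∈ s', Five (fun l => LP G x (p 1) l ∧ ∀ t ∈ l, t ∈ s) := fun x hx =>
        hold x hx (p 1) m1 n1 h13.symm
          (five_K4 m3 m1 m0 m2 h13.symm hcl.symm h23.symm h01.symm h12 h02)
      have o2 : ∀ x ∈ s', Five (fun l => LP G x (p 2) l ∧ ∀ t ∈ l, t ∈ s) := fun x hx =>
        hold x hx (p 2) m2 n2 h23.symm
          (five_K4 m3 m2 m0 m1 h23.symm hcl.symm h13.symm h02.symm h12.symm h01)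
      have f01 : Five (fun l => LP G (p 0) (p 1) l ∧ ∀ t ∈ l, t ∈ s) :=
        five_K4 m0 m1 m2 m3 h01 h02 hcl h12 h13 h23
      have f02 : Five (fun l => LP G (p 0) (p 2) l ∧ ∀ t ∈ l, t ∈ s) :=
        five_K4 m0 m2 m1 m3 h02 h01 hcl h12.symm h23 h13
      have f12 : Five (fun l => LP G (p 1) (p 2) l ∧ ∀ t ∈ l, t ∈ s) :=
        five_K4 m1 m2 m0 m3 h12 h01.symm h13 h02.symm h23 hcl
      intro x hx y hy hxy
      rcases hmem x hx with rfl | rfl | rfl | hx' <;> rcases hmem y hy with rfl | rfl | rfl | hy'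
      · exact absurd rfl hxy
      · exact f01
      · exact f02
      · exact five_rev (o0 y hy')
      · exact five_rev f01
      · exact absurd rfl hxy
      · exact f12
      · exact five_rev (o1 y hy')
      · exact five_rev f02
      · exact five_rev f12
      · exact absurd rfl hxy
      · exact five_rev (o2 y hy')
      · exact o0 x hx'
      · exact o1 x hx'
      · exact o2 x hx'
      · exact (h5 x hx' y hy' hxy).imp fun l hl => ⟨hl.1, fun t ht => hsub (hl.2 t ht)⟩
    · obtain ⟨rfl, hN⟩ := h
      have hd : ∀ a b, a ≤ 4 → b ≤ 4 → a ≠ b → p a ≠ p b := fun a b ha hb hab h => hab (hinj a b ha hb h)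
      have m0 := hps 0 (by omega)
      have m1 : p 1 ∈ s.erase (p 0) :=
        Finset.mem_erase.2 ⟨hd _ _ (by omega) (by omega) (by omega), hps 1 (by omega)⟩
      have m2 : p 2 ∈ (s.erase (p 0)).erase (p 1) := by
        refine Finset.mem_erase.2 ⟨hd _ _ (by omega) (by omega) (by omega), Finset.mem_erase.2
          ⟨hd _ _ (by omega) (by omega) (by omega), hps 2 (by omega)⟩⟩
      have m3 : p 3 ∈ ((s.erase (p 0)).erase (p 1)).erase (p 2) := by
        refine Finset.mem_erase.2 ⟨hd _ _ (by omega) (by omega) (by omega), Finset.mem_erase.2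
          ⟨hd _ _ (by omega) (by omega) (by omega), Finset.mem_erase.2
          ⟨hd _ _ (by omega) (by omega) (by omega), hps 3 (by omega)⟩⟩⟩
      have m4 : p 4 ∈ (((s.erase (p 0)).erase (p 1)).erase (p 2)).erase (p 3) := by
        refine Finset.mem_erase.2 ⟨hd _ _ (by omega) (by omega) (by omega), Finset.mem_erase.2
          ⟨hd _ _ (by omega) (by omega) (by omega), Finset.mem_erase.2
          ⟨hd _ _ (by omega) (by omega) (by omega), Finset.mem_erase.2
          ⟨hd _ _ (by omega) (by omega) (by omega), hps 4 (by omega)⟩⟩⟩⟩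
      have c0 := Finset.card_erase_of_mem m0
      have c1 := Finset.card_erase_of_mem m1
      have c2 := Finset.card_erase_of_mem m2
      have c3 := Finset.card_erase_of_mem m3
      have b0 := eN_erase_le G m0 {p 1, p 2, p 4} (by
        intro w hw ha
        obtain ⟨t, ht, hta, rfl, hh⟩ := hN 0 (by omega) w hw ha
        interval_cases t <;> simp at hta hh ⊢)
      have b1 := eN_erase_le G m1 {p 2, p 3} (by
        intro w hw ha
        obtain ⟨t, ht, hta, rfl, hh⟩ := hN 1 (by omega) w (Finset.mem_of_mem_erase hw) ha
        interval_cases t <;> simp at hta hw hh ⊢)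
      have b2 := eN_erase_le G m2 {p 3} (by
        intro w hw ha
        obtain ⟨t, ht, hta, rfl, hh⟩ := hN 2 (by omega) w
          (Finset.mem_of_mem_erase (Finset.mem_of_mem_erase hw)) ha
        interval_cases t <;> simp at hta hw hh ⊢)
      have b3 := eN_erase_le G m3 {p 4} (by
        intro w hw ha
        obtain ⟨t, ht, hta, rfl, hh⟩ := hN 3 (by omega) w
          (Finset.mem_of_mem_erase (Finset.mem_of_mem_erase (Finset.mem_of_mem_erase hw))) ha
        interval_cases t <;> simp at hta hw hh ⊢)
      have k0 : ({p 1, p 2, p 4} : Finset V).card ≤ 3 := Finset.card_le_three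
      have k1 : ({p 2, p 3} : Finset V).card ≤ 2 := Finset.card_le_two
      have k2 : ({p 3} : Finset V).card = 1 := Finset.card_singleton _
      have k3 : ({p 4} : Finset V).card = 1 := Finset.card_singleton _
      have hne : ((((s.erase (p 0)).erase (p 1)).erase (p 2)).erase (p 3)).Nonempty := ⟨_, m4⟩
      have hp3 := hne.card_pos
      have ih' := (ih _ (by omega) ((((s.erase (p 0)).erase (p 1)).erase (p 2)).erase (p 3)) rfl hne).1
      refine ⟨by omega, fun _ => by omega⟩


theorem upper_bound (V : Type) [Fintype V] (G : SimpleGraph V) (hG : IsKCactus G 4) :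
    (Fintype.card V % 3 = 1 → G.edgeSet.ncard ≤ 2 * Fintype.card V - 2) ∧
    (Fintype.card V % 3 ≠ 1 → G.edgeSet.ncard ≤ 2 * Fintype.card V - 3) := by
  classical
  have hne : Nonempty V := hG.1.nonempty
  have hNF : NF G := fun x y h => noFive hG h
  have hm := main_bound hNF _ Finset.univ rfl Finset.univ_nonempty
  have he : eN G Finset.univ = 2 * G.edgeSet.ncard := by
    have h1 := G.sum_degrees_eq_twice_card_edges
    have h2 : G.edgeSet.ncard = G.edgeFinset.card := by
      rw [← coe_edgeFinset, Set.ncard_coe_finset]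
    rw [h2, ← h1]
    unfold eN
    refine Finset.sum_congr rfl fun v _ => ?_
    rw [← card_neighborFinset_eq_degree, neighborFinset_eq_filter]
  rw [he, Finset.card_univ] at hm
  obtain ⟨h1, h2⟩ := hm
  refine ⟨fun _ => by omega, fun h => ?_⟩
  by_cases ht : 2 * G.edgeSet.ncard + 4 = 4 * Fintype.card V
  · exact absurd (h2 ht).1 h
  · omega

/-- the windmill graph: copies of `K₄` glued at the vertex `0`, plus a remainder block -/
def mill (n : ℕ) : SimpleGraph (Fin n) where
  Adj u v := u ≠ v ∧ (u.val = 0 ∨ v.val = 0 ∨ (u.val - 1) / 3 = (v.val - 1) / 3)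
  symm := ⟨fun u v h => ⟨h.1.symm, by omega⟩⟩
  loopless := ⟨fun u h => h.1 rfl⟩

theorem mill_connected (n : ℕ) (hn : 1 ≤ n) : (mill n).Connected := by
  have : Nonempty (Fin n) := ⟨⟨0, hn⟩⟩
  have h0 : ∀ v : Fin n, (mill n).Reachable ⟨0, hn⟩ v := by
    intro v
    by_cases hv : (⟨0, hn⟩ : Fin n) = v
    · rw [hv]
    · exact Adj.reachable ⟨hv, Or.inl rfl⟩
  exact ⟨fun u v => (h0 u).symm.trans (h0 v)⟩

/-- A block-confined path count bounds the number of cycles through an edge. -/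
theorem cycles_le_four {V : Type} [Fintype V] [DecidableEq V] {G : SimpleGraph V} {x y : V}
    (h : G.Adj x y) (B : Finset V) (hx : x ∈ B) (hy : y ∈ B) (hB : B.card ≤ 4)
    (hconf : ∀ p : G.Walk y x, p.IsPath → ∀ t ∈ p.support, t ∈ B) :
    (CyclesThrough G s(x, y)).ncard ≤ 4 := by
  let S : Set (G.Walk y x) := {p | p.IsPath ∧ 2 ≤ p.length}
  have h1 : CyclesThrough G s(x, y) ⊆ (fun p : G.Walk y x => (Walk.cons h p).toSubgraph) '' S := by
    rintro C ⟨⟨v, w, hw, rfl⟩, he⟩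
    rw [Walk.mem_edges_toSubgraph] at he
    have hxw := w.fst_mem_support_of_mem_edges he
    have hfin : ∀ q : G.Walk y x, (Walk.cons h q).IsCycle →
        (Walk.cons h q).toSubgraph = w.toSubgraph →
        w.toSubgraph ∈ (fun p : G.Walk y x => (Walk.cons h p).toSubgraph) '' S := by
      intro q hq hqw
      refine ⟨q, ⟨((Walk.cons_isCycle_iff _ _).1 hq).1, ?_⟩, hqw⟩
      have := hq.three_le_length
      rw [Walk.length_cons] at this
      omega
    have hr := hw.rotate hxw
    have hrs := Walk.toSubgraph_rotate w hxw
    have hre : s(x, y) ∈ (w.rotate x hxw).edges := by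
      rw [← Walk.mem_edges_toSubgraph, hrs, Walk.mem_edges_toSubgraph]; exact he
    generalize w.rotate x hxw = c at hr hrs hre
    cases c with
    | nil => simp at hre
    | @cons _ b _ hb p =>
      rw [Walk.edges_cons, List.mem_cons] at hre
      rcases hre with h' | h'
      · have hyb : y = b := by
          have := hb.ne
          have : y = b ∨ x = b ∧ y = x := by simpa using h'
          grind
        subst hyb
        exact hfin p hr hrs
      · have hpp := ((Walk.cons_isCycle_iff _ _).1 hr).1
        have hr2 := hr.reverse
        have hrs2 := (Walk.toSubgraph_reverse (Walk.cons hb p)).trans hrs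
        rw [Walk.reverse_cons] at hr2 hrs2
        have hpr := hpp.reverse
        have h'' : s(x, y) ∈ p.reverse.edges := by simpa using h'
        generalize p.reverse = r at hr2 hrs2 hpr h''
        cases r with
        | nil => simp at h''
        | @cons _ a _ ha q =>
          rw [Walk.cons_isPath_iff] at hpr
          rw [Walk.edges_cons, List.mem_cons] at h''
          rcases h'' with h3 | h3
          · have hya : y = a := by
              have := ha.ne
              have : y = a ∨ x = a ∧ y = x := by simpa using h3
              grind
            subst hya
            rw [Walk.cons_append] at hr2 hrs2
            exact hfin _ hr2 hrs2
          · exact absurd (q.fst_mem_support_of_mem_edges h3) hpr.2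
  obtain ⟨c, d, hcd⟩ : ∃ c d, ∀ t ∈ B, t = x ∨ t = y ∨ t = c ∨ t = d := by
    have hc2 : ((B.erase x).erase y).card ≤ 2 := by
      rw [Finset.card_erase_of_mem (Finset.mem_erase.2 ⟨h.ne', hy⟩), Finset.card_erase_of_mem hx]
      omega
    have hm : ∀ t ∈ B, t = x ∨ t = y ∨ t ∈ (B.erase x).erase y := by
      intro t ht; simp only [Finset.mem_erase]; tauto
    generalize (B.erase x).erase y = E at *
    obtain h0 | h0 | h0 : E.card = 0 ∨ E.card = 1 ∨ E.card = 2 := by omega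
    · rw [Finset.card_eq_zero] at h0
      subst h0
      exact ⟨x, x, fun t ht => by have := hm t ht; simp at this; tauto⟩
    · obtain ⟨c, rfl⟩ := Finset.card_eq_one.1 h0
      exact ⟨c, c, fun t ht => by have := hm t ht; simp at this; tauto⟩
    · obtain ⟨c, d, -, rfl⟩ := Finset.card_eq_two.1 h0
      exact ⟨c, d, fun t ht => by have := hm t ht; simp at this; tauto⟩
  let T : Finset (List V) := {[y, c, x], [y, d, x], [y, c, d, x], [y, d, c, x]}
  have hTc : T.card ≤ 4 := Finset.card_le_four
  have h2 : ∀ p ∈ S, p.support ∈ (T : Set (List V)) := by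
    rintro p ⟨hp, hl⟩
    have hcon := hconf p hp
    have hnd := hp.support_nodup
    have hcard : p.support.length = p.length + 1 := p.length_support
    have hhead := p.cons_tail_support.symm
    have hlast : p.support.getLast? = some x := by
      rw [List.getLast?_eq_some_getLast p.support_ne_nil, Walk.getLast_support]
    have hcon' : ∀ t ∈ p.support, t = x ∨ t = y ∨ t = c ∨ t = d := fun t ht => hcd t (hcon t ht)
    have hle : p.support.length ≤ 4 := by
      rw [← List.toFinset_card_of_nodup hnd]
      refine le_trans (Finset.card_le_card ?_) (Finset.card_le_four (a := x) (b := y) (c := c) (d := d))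
      intro t ht
      have := hcon' t (by simpa using ht)
      simpa using this
    generalize p.support = l at *
    have hxy := h.ne
    match l, hhead with
    | [], hh => simp at hcard
    | [a], hh => rw [List.length_singleton] at hcard; omega
    | [a, b], hh => simp at hcard; omega
    | [a, b, e], hh =>
      simp at hh hlast hnd hcon'
      subst hh hlast
      simp [T]
      grind
    | [a, b, e, f], hh =>
      simp at hh hlast hnd hcon'
      subst hh hlast
      simp [T]
      grind
    | a :: b :: e :: f :: g :: l, hh => simp at hle; omega
  have hSfin : S.Finite := by
    refine Set.Finite.of_finite_image (f := fun p : G.Walk y x => p.support)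
      (T.finite_toSet.subset ?_) fun p _ q _ hpq => Walk.ext_support hpq
    rintro _ ⟨p, hp, rfl⟩
    exact h2 p hp
  calc (CyclesThrough G s(x, y)).ncard
      ≤ ((fun p : G.Walk y x => (Walk.cons h p).toSubgraph) '' S).ncard :=
        Set.ncard_le_ncard h1 (hSfin.image _)
    _ ≤ S.ncard := Set.ncard_image_le hSfin
    _ ≤ (T : Set (List V)).ncard := Set.ncard_le_ncard_of_injOn (fun p => p.support) h2
        (fun p _ q _ hpq => Walk.ext_support hpq) T.finite_toSet
    _ ≤ 4 := by rw [Set.ncard_coe_finset]; exact hTc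

/-- vertex lies in the block number `k` -/
def inB (n k : ℕ) (v : Fin n) : Prop := v.val = 0 ∨ (v.val - 1) / 3 = k

theorem mill_leave {n k : ℕ} {u v : Fin n} (p : (mill n).Walk u v) :
    inB n k u → ¬ inB n k v → ∃ z ∈ p.support, z.val = 0 := by
  induction p with
  | nil => intro h1 h2; exact absurd h1 h2
  | @cons u a w h p ih =>
    intro h1 h2
    by_cases ha : inB n k a
    · obtain ⟨z, hz, hz0⟩ := ih ha h2
      exact ⟨z, by simp [hz], hz0⟩
    · refine ⟨u, by simp, ?_⟩
      obtain ⟨-, h⟩ := h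
      unfold inB at ha h1
      omega

theorem mill_conf {n k : ℕ} {u v : Fin n} (p : (mill n).Walk u v) (hp : p.IsPath)
    (hu : inB n k u) (hv : inB n k v) : ∀ t ∈ p.support, inB n k t := by
  intro t ht
  by_contra hcon
  obtain ⟨z, hz, hz0⟩ := mill_leave (p.takeUntil t ht) hu hcon
  obtain ⟨z', hz', hz0'⟩ := mill_leave (p.dropUntil t ht).reverse hv hcon
  have hzz : z = z' := Fin.ext (by omega)
  subst hzz
  rw [Walk.support_reverse, List.mem_reverse] at hz'
  have hne : z ≠ t := by
    rintro rfl
    exact hcon (Or.inl hz0)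
  have hnd := hp.support_nodup
  rw [← p.take_spec ht, Walk.support_append, List.nodup_append] at hnd
  refine hnd.2.2 z hz z ?_ rfl
  rw [← Walk.cons_tail_support, List.mem_cons] at hz'
  exact hz'.resolve_left hne

theorem mill_cactus (n : ℕ) (hn : 1 ≤ n) : IsKCactus (mill n) 4 := by
  classical
  refine ⟨mill_connected n hn, ?_⟩
  intro e
  induction e using Sym2.ind with
  | _ x y =>
  intro h
  rw [mem_edgeSet] at h
  obtain ⟨k, hx, hy⟩ : ∃ k, inB n k x ∧ inB n k y := by
    obtain ⟨h1, h2⟩ := h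
    unfold inB
    by_cases hx : x.val = 0
    · exact ⟨(y.val - 1) / 3, by omega, by omega⟩
    · exact ⟨(x.val - 1) / 3, by omega, by omega⟩
  refine cycles_le_four h (Finset.univ.filter (inB n k)) (by simpa using hx) (by simpa using hy) ?_ ?_
  · have : ((Finset.univ.filter (inB n k)).image (fun v : Fin n => v.val)) ⊆
        {0, 3 * k + 1, 3 * k + 2, 3 * k + 3} := by
      intro t ht
      simp only [Finset.mem_image, Finset.mem_filter, Finset.mem_univ, true_and] at ht
      obtain ⟨v, hv, rfl⟩ := ht
      unfold inB at hv
      simp only [Finset.mem_insert, Finset.mem_singleton]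
      omega
    have := (Finset.card_le_card this).trans Finset.card_le_four
    rwa [Finset.card_image_of_injective _ Fin.val_injective] at this
  · intro p hp t ht
    simpa using mill_conf p hp hy hx t ht

theorem mill_sum (n : ℕ) (hn : 1 ≤ n) :
    (∑ v ∈ Finset.range n, if v = 0 then 0 else 1 + (v - 1) % 3) =
      if n % 3 = 1 then 2 * n - 2 else 2 * n - 3 := by
  induction n with
  | zero => omega
  | succ m ih =>
    rcases Nat.eq_zero_or_pos m with rfl | hm
    · simp
    · rw [Finset.sum_range_succ, ih hm, if_neg (show ¬ m = 0 by omega)]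
      split_ifs <;> omega

theorem mill_edges (n : ℕ) (hn : 1 ≤ n) :
    (mill n).edgeSet.ncard = if n % 3 = 1 then 2 * n - 2 else 2 * n - 3 := by
  classical
  -- edges as ordered pairs
  let P : Finset (ℕ × ℕ) := (Finset.range n).biUnion fun v =>
    ((Finset.range v).filter fun u => u = 0 ∨ (u - 1) / 3 = (v - 1) / 3).image fun u => (u, v)
  have h1 : (mill n).edgeSet.ncard = P.card := by
    rw [← Set.ncard_coe_finset P]
    symm
    refine Set.ncard_congr (fun a ha => if h : a.1 < n ∧ a.2 < n then s(⟨a.1, h.1⟩, ⟨a.2, h.2⟩) else s(⟨0, hn⟩, ⟨0, hn⟩)) ?_ ?_ ?_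
    · rintro ⟨u, v⟩ ha
      simp [P] at ha
      rw [dif_pos ⟨by omega, by omega⟩, mem_edgeSet]
      refine ⟨?_, ?_⟩
      · intro h; simp at h; omega
      · simp; omega
    · rintro ⟨u, v⟩ ⟨u', v'⟩ ha hb
      simp [P] at ha hb
      rw [dif_pos ⟨by omega, by omega⟩, dif_pos ⟨by omega, by omega⟩]
      intro h
      simp at h ⊢
      omega
    · intro e
      induction e using Sym2.ind with
      | _ x y =>
      intro h
      rw [mem_edgeSet] at h
      obtain ⟨h1, h2⟩ := h
      have h1' : x.val ≠ y.val := fun h => h1 (Fin.ext h)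
      rcases lt_or_gt_of_ne h1' with hlt | hlt
      · refine ⟨(x.val, y.val), ?_, ?_⟩
        · simp [P]; omega
        · simp
      · refine ⟨(y.val, x.val), ?_, ?_⟩
        · simp [P]; omega
        · simp [Sym2.eq_swap]
  have h2 : P.card = ∑ v ∈ Finset.range n, if v = 0 then 0 else 1 + (v - 1) % 3 := by
    rw [Finset.card_biUnion]
    · refine Finset.sum_congr rfl fun v _ => ?_
      rw [Finset.card_image_of_injective _ (fun a b h => by simpa using h)]
      split_ifs with hv
      · subst hv; simp
      · have : (Finset.range v).filter (fun u => u = 0 ∨ (u - 1) / 3 = (v - 1) / 3) =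
            insert 0 (Finset.Ico ((v - 1) / 3 * 3 + 1) v) := by
          ext u; simp; omega
        rw [this, Finset.card_insert_of_notMem (by simp), Nat.card_Ico]
        omega
    · intro v _ w _ hvw
      rw [Function.onFun, Finset.disjoint_left]
      rintro ⟨a, b⟩ h1 h2
      simp at h1 h2
      omega
  rw [h1, h2]
  exact mill_sum n hn

/-- Every 4-cactus with `n` vertices has at most `2n - 2` edges if `n ≡ 1 (mod 3)`
and at most `2n - 3` edges otherwise; the bounds are attained for every `n ≥ 1`. -/
theorem four_cactus_size :
    (∀ (V : Type) [Fintype V] (G : SimpleGraph V), IsKCactus G 4 →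
      (Fintype.card V % 3 = 1 → G.edgeSet.ncard ≤ 2 * Fintype.card V - 2) ∧
      (Fintype.card V % 3 ≠ 1 → G.edgeSet.ncard ≤ 2 * Fintype.card V - 3)) ∧
    (∀ n : ℕ, 1 ≤ n → ∃ G : SimpleGraph (Fin n), IsKCactus G 4 ∧
      G.edgeSet.ncard = if n % 3 = 1 then 2 * n - 2 else 2 * n - 3) := by
  exact ⟨fun V _ G hG => upper_bound V G hG,
    fun n hn => ⟨mill n, mill_cactus n hn, mill_edges n hn⟩⟩
end
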